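/- Let $p_1 = 2 < p_2 = 3 < p_3 < \cdots$ be the sequence of all primes, let $\varphi$ be Euler's totient function and $\gamma$ the Euler–Mascheroni constant, and let $c_0 \ge 1$ be a fixed constant. There exists a constant $c_1 > 0$ such that there are infinitely many positive integers $N$ of the form $N = p_1^{v_1} p_2^{v_2} \cdots p_k^{v_k}$, with $k \ge 1$, all $v_i \ge 1$ and $p_k \le c_0 \log N$, for which $$\frac{N}{\varphi(N)} \ \ge\ e^{\gamma} \log\log N + c_1\, \frac{(\log N)^{-1/2}\, \log\log\log\log N}{\log\log N}.$$ -/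

import Mathlib

/-- `N = p₁^{v₁} p₂^{v₂} ⋯ p_k^{v_k}` where `p₁ = 2 < p₂ = 3 < ⋯ < p_k` are the first `k ≥ 1` primes,
all exponents `v_i` are at least `1`, and the largest prime satisfies `p_k ≤ y`.
(`Nat.nth Nat.Prime i` is the prime number of index `i`, counted from `0`, so the product over
`Finset.range (k + 1)` runs over the first `k + 1` primes and the last one is
`Nat.nth Nat.Prime k`.) -/
def IsInitialPrimeProduct (N : ℕ) (y : ℝ) : Prop :=
  ∃ (k : ℕ) (v : ℕ → ℕ),
    (∀ i ≤ k, 1 ≤ v i) ∧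
    N = ∏ i ∈ Finset.range (k + 1), Nat.nth Nat.Prime i ^ v i ∧
    (Nat.nth Nat.Prime k : ℝ) ≤ y

open MeasureTheory ProbabilityTheory Set Filter Topology

/-- Landau's lemma at one point: the moment generating function of a nonnegative variable, finite
to the left of `T` and extending analytically across `T`, is finite somewhere beyond `T`. -/
theorem exists_gt_mem_integrableExpSet_of_analyticAt {Ω : Type*} [MeasurableSpace Ω]
    {μ : Measure Ω} {X : Ω → ℝ} (hX : ∀ᵐ ω ∂μ, 0 ≤ X ω) {g : ℝ → ℝ} {T : ℝ}
    (hT : Iio T ⊆ interior (integrableExpSet X μ)) (hg : AnalyticAt ℝ g T)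
    (heq : EqOn (mgf X μ) g (Iio T)) :
    ∃ t, T < t ∧ t ∈ integrableExpSet X μ := by
  rcases eq_or_ne μ 0 with rfl | hμ
  · exact ⟨T + 1, by linarith, by simp [integrableExpSet]⟩
  obtain ⟨p, R, hp⟩ := hg
  obtain ⟨r, hr, hrR⟩ : ∃ r : NNReal, 0 < r ∧ (r : ENNReal) ≤ R := by
    obtain ⟨r, h1, h2⟩ := ENNReal.lt_iff_exists_nnreal_btwn.1 hp.r_pos
    exact ⟨r, by exact_mod_cast h1, h2.le⟩
  have hp := hp.mono (by exact_mod_cast hr) hrR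
  have hr' : (0 : ℝ) < r := by exact_mod_cast hr
  set h : ℝ := r / 4 with hh
  have hh0 : 0 < h := by positivity
  have hnorm : ‖-h‖₊ = r / 4 := by
    ext; simp [hh]
  have hlt : (‖-h‖₊ : ENNReal) < r := by
    rw [hnorm]
    exact_mod_cast NNReal.coe_lt_coe.1 (by push_cast; linarith)
  have hq := hp.changeOrigin hlt
  set a : ℝ := T + -h with ha
  have haT : a < T := by linarith
  have haI := hT haT
  have hmgf := (hasFPowerSeriesAt_mgf haI).congr
    (eventually_of_mem (Iio_mem_nhds haT) (fun t ht ↦ heq ht))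
  have hpq := hq.hasFPowerSeriesAt.eq_formalMultilinearSeries hmgf
  have hmem : 2 * h ∈ Metric.eball (0 : ℝ) ((r : ENNReal) - ‖-h‖₊) := by
    rw [hnorm, Metric.mem_eball, edist_zero_right, enorm_eq_nnnorm, ← ENNReal.coe_sub]
    have : ‖2 * h‖₊ < r - r / 4 := by
      rw [← NNReal.coe_lt_coe, NNReal.coe_sub (NNReal.coe_le_coe.1 (by push_cast; linarith))]
      simp only [coe_nnnorm, Real.norm_eq_abs, abs_of_pos (by positivity : 0 < 2 * h)]
      push_cast
      linarith
    exact_mod_cast this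
  have hs := hq.hasSum hmem
  rw [hpq] at hs
  simp only [FormalMultilinearSeries.ofScalars_apply_eq, smul_eq_mul] at hs
  refine ⟨a + 2 * h, by linarith, ?_⟩
  have hint (n : ℕ) : Integrable (fun ω ↦ (X ω ^ n * Real.exp (a * X ω)) * ((2 * h) ^ n / n.factorial)) μ :=
    (integrable_pow_mul_exp_of_mem_interior_integrableExpSet haI n).mul_const _
  have hsumm : Summable fun n : ℕ ↦
      ∫ ω, ‖(X ω ^ n * Real.exp (a * X ω)) * ((2 * h) ^ n / n.factorial)‖ ∂μ := by
    refine hs.summable.congr fun n ↦ ?_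
    have : ∫ ω, ‖(X ω ^ n * Real.exp (a * X ω)) * ((2 * h) ^ n / n.factorial)‖ ∂μ =
        ∫ ω, (X ω ^ n * Real.exp (a * X ω)) * ((2 * h) ^ n / n.factorial) ∂μ := by
      refine integral_congr_ae ?_
      filter_upwards [hX] with ω hω
      rw [Real.norm_of_nonneg (by positivity)]
    rw [this, integral_mul_const]
    rw [div_mul_eq_mul_div, mul_div_assoc]
  have H := hasSum_integral_of_summable_integral_norm hint hsumm
  have hexp : ∀ ω, ∑' n : ℕ, (X ω ^ n * Real.exp (a * X ω)) * ((2 * h) ^ n / n.factorial) =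
      Real.exp ((a + 2 * h) * X ω) := by
    intro ω
    rw [show (a + 2 * h) * X ω = a * X ω + 2 * h * X ω by ring, Real.exp_add,
      Real.exp_eq_exp_ℝ, congrFun NormedSpace.exp_eq_tsum_div (2 * h * X ω), ← tsum_mul_left]
    refine tsum_congr fun n ↦ ?_
    rw [mul_pow (2 * h), mul_div_right_comm, mul_comm (X ω ^ n), mul_assoc, mul_comm (X ω ^ n)]
  simp only [hexp] at H
  have hpos : 0 < ∫ ω, Real.exp ((a + 2 * h) * X ω) ∂μ := by
    have h0 : ∫ ω, (X ω ^ 0 * Real.exp (a * X ω)) * ((2 * h) ^ 0 / Nat.factorial 0) ∂μ =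
      mgf X μ a := by simp [mgf]
    have h1 := mgf_pos' hμ (interior_subset haI : a ∈ integrableExpSet X μ)
    rw [← h0] at h1
    refine h1.trans_le (le_hasSum H 0 fun n _ ↦ ?_)
    refine integral_nonneg_of_ae ?_
    filter_upwards [hX] with ω hω
    simp only [Pi.zero_apply]
    positivity
  exact Integrable.of_integral_ne_zero hpos.ne'

/-- Landau's theorem for moment generating functions of nonnegative variables. -/
theorem mgf_eq_of_analyticOnNhd {Ω : Type*} [MeasurableSpace Ω] {μ : Measure Ω} {X : Ω → ℝ}
    (hXm : Measurable X) (hX : ∀ᵐ ω ∂μ, 0 ≤ X ω) {g : ℝ → ℝ} {a b : ℝ}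
    (hg : AnalyticOnNhd ℝ g (Iio b)) (hint : Iio a ⊆ integrableExpSet X μ)
    (heq : EqOn (mgf X μ) g (Iio a)) : EqOn (mgf X μ) g (Iio b) := by
  have hdown : ∀ t ∈ integrableExpSet X μ, ∀ t' ≤ t, t' ∈ integrableExpSet X μ := by
    intro t ht t' htt'
    refine Integrable.mono' ht (by fun_prop) ?_
    filter_upwards [hX] with ω hω
    rw [Real.norm_of_nonneg (Real.exp_nonneg _), Real.exp_le_exp]
    gcongr
  have hsub : ∀ T, Iio T ⊆ integrableExpSet X μ → Iio T ⊆ interior (integrableExpSet X μ) :=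
    fun T hT ↦ interior_maximal hT isOpen_Iio
  have hagree : ∀ T ≤ b, Iio T ⊆ integrableExpSet X μ → EqOn (mgf X μ) g (Iio T) := by
    intro T hTb hT
    refine (analyticOnNhd_mgf.mono (hsub T hT)).eqOn_of_preconnected_of_eventuallyEq
      (hg.mono (Iio_subset_Iio hTb)) isPreconnected_Iio (z₀ := min a T - 1)
      (mem_Iio.2 (by linarith [min_le_right a T])) ?_
    exact eventually_of_mem (Iio_mem_nhds (by linarith [min_le_left a T])) (fun t ht ↦ heq ht)
  refine hagree b le_rfl ?_
  by_contra hcon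
  obtain ⟨τ, hτb, hτ⟩ := not_subset.1 hcon
  have hub : ∀ t ∈ integrableExpSet X μ, t ≤ τ := fun t ht ↦ by
    by_contra hlt
    exact hτ (hdown t ht τ (not_le.1 hlt).le)
  have hbdd : BddAbove (integrableExpSet X μ) := ⟨τ, hub⟩
  have hne : (integrableExpSet X μ).Nonempty := ⟨a - 1, hint (by simp)⟩
  set T := sSup (integrableExpSet X μ) with hT
  have hTb : T < b := (csSup_le hne hub).trans_lt hτb
  have hTI : Iio T ⊆ integrableExpSet X μ := fun t ht ↦ by
    obtain ⟨t', ht', htt'⟩ := exists_lt_of_lt_csSup hne ht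
    exact hdown t' ht' t htt'.le
  obtain ⟨t, htT, ht⟩ := exists_gt_mem_integrableExpSet_of_analyticAt hX (hsub T hTI) (hg T hTb)
    (hagree T hTb.le hTI)
  exact absurd (le_csSup hbdd ht) (not_le.2 htT)

/-- Landau's theorem for Laplace transforms: if `f ≥ 0` has Laplace transform `G` on a half-line and
`G` is real analytic on the larger half-line `(b, ∞)`, then `G ≥ 0` there. -/
theorem laplace_extension_nonneg {f G : ℝ → ℝ} {a b : ℝ}
    (hfm : Measurable f) (hf : ∀ u, 0 < u → 0 ≤ f u) (hG : AnalyticOnNhd ℝ G (Ioi b))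
    (hint : ∀ s, a < s → IntegrableOn (fun u ↦ f u * Real.exp (-s * u)) (Ioi 0))
    (heq : ∀ s, a < s → ∫ u in Ioi 0, f u * Real.exp (-s * u) = G s) :
    ∀ s, b < s → 0 ≤ G s := by
  set μ : Measure ℝ := (volume.restrict (Ioi 0)).withDensity fun u ↦ (f u).toNNReal with hμ
  have hm : Measurable fun u ↦ (f u).toNNReal := hfm.real_toNNReal
  have hsm : ∀ (t : ℝ), ∀ u ∈ Ioi (0 : ℝ), (f u).toNNReal • Real.exp (t * u) =
      f u * Real.exp (- -t * u) := by
    intro t u hu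
    rw [NNReal.smul_def, Real.coe_toNNReal _ (hf u hu), smul_eq_mul, neg_neg]
  have hmgf : ∀ t, mgf id μ t = ∫ u in Ioi 0, f u * Real.exp (- -t * u) := by
    intro t
    rw [mgf, hμ, integral_withDensity_eq_integral_smul hm]
    exact setIntegral_congr_fun measurableSet_Ioi (hsm t)
  have hmem : Iio (-a) ⊆ integrableExpSet id μ := by
    intro t ht
    change Integrable _ _
    rw [hμ, integrable_withDensity_iff_integrable_smul hm]
    exact (integrableOn_congr_fun (hsm t) measurableSet_Ioi).2 (hint (-t) (by linarith [mem_Iio.1 ht]))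
  have hX : ∀ᵐ u ∂μ, 0 ≤ id u := by
    refine (withDensity_absolutelyContinuous _ _).ae_le ?_
    exact (ae_restrict_mem measurableSet_Ioi).mono fun u hu ↦ le_of_lt hu
  have hg : AnalyticOnNhd ℝ (fun t ↦ G (-t)) (Iio (-b)) := fun t ht ↦
    (hG (-t) (by simpa using lt_neg.1 (mem_Iio.1 ht))).fun_comp analyticAt_id.neg
  have key := mgf_eq_of_analyticOnNhd measurable_id hX hg hmem fun t ht ↦ by
    rw [hmgf]
    exact heq _ (by linarith [mem_Iio.1 ht])
  intro s hs
  have := key (x := -s) (by simpa using hs)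
  simp only [neg_neg] at this
  rw [← this]
  exact mgf_nonneg

/-- The real function `s ↦ s ζ(1 + s)`, with the value `1` at `s = 0`. -/
noncomputable def zetaShift (s : ℝ) : ℝ :=
  (Function.update (fun w : ℂ ↦ (w - 1) * riemannZeta w) 1 1 (1 + (s : ℂ))).re

theorem differentiable_update_sub_one_mul_riemannZeta :
    Differentiable ℂ (Function.update (fun w : ℂ ↦ (w - 1) * riemannZeta w) 1 1) := by
  rw [← differentiableOn_univ, ← Complex.differentiableOn_compl_singleton_and_continuousAt_iff
    (c := 1) univ_mem]
  refine ⟨fun w hw ↦ ?_, ?_⟩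
  · have hw1 : w ≠ 1 := by simpa using hw
    refine (((differentiableAt_id.sub_const 1).mul
      (differentiableAt_riemannZeta hw1)).congr_of_eventuallyEq ?_).differentiableWithinAt
    filter_upwards [isOpen_ne.mem_nhds hw1] with z hz
    simp [Function.update_of_ne hz]
  · simpa only [continuousAt_update_same] using riemannZeta_residue_one

theorem analyticAt_zetaShift (s : ℝ) : AnalyticAt ℝ zetaShift s := by
  have h : AnalyticAt ℂ (fun z : ℂ ↦
      Function.update (fun w : ℂ ↦ (w - 1) * riemannZeta w) 1 1 (1 + z)) s :=
    (differentiable_update_sub_one_mul_riemannZeta.comp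
      (differentiable_id.const_add 1)).analyticAt _
  exact h.re_ofReal

theorem zetaShift_zero : zetaShift 0 = 1 := by simp [zetaShift]

theorem zetaShift_of_ne_zero {s : ℝ} (hs : s ≠ 0) :
    zetaShift s = s * (riemannZeta ((1 + s : ℝ) : ℂ)).re := by
  have : (1 + (s : ℂ)) ≠ 1 := by simpa using hs
  rw [zetaShift, Function.update_of_ne this]
  push_cast
  rw [add_sub_cancel_left, Complex.re_ofReal_mul]

theorem LSeries.term_ofReal (a : ℕ → ℝ) {w : ℝ} (hw : w ≠ 0) (n : ℕ) :
    LSeries.term (fun n ↦ (a n : ℂ)) w n = ((a n * (n : ℝ) ^ (-w) : ℝ) : ℂ) := by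
  rcases eq_or_ne n 0 with rfl | hn
  · simp [Real.zero_rpow (neg_ne_zero.2 hw)]
  · rw [LSeries.term_of_ne_zero hn, Real.rpow_neg (by positivity)]
    push_cast
    rw [Complex.ofReal_cpow (by positivity), Complex.ofReal_natCast, div_eq_mul_inv]

theorem LSeriesSummable.hasSum_ofReal {a : ℕ → ℝ} {w : ℝ} (hw : w ≠ 0)
    (h : LSeriesSummable (fun n ↦ (a n : ℂ)) w) :
    HasSum (fun n : ℕ ↦ a n * (n : ℝ) ^ (-w)) (LSeries (fun n ↦ (a n : ℂ)) w).re ∧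
      LSeries (fun n ↦ (a n : ℂ)) w = ((LSeries (fun n ↦ (a n : ℂ)) w).re : ℂ) := by
  have h1 := h.LSeriesHasSum
  unfold _root_.LSeriesHasSum at h1
  rw [funext (LSeries.term_ofReal a hw)] at h1
  have h2 := Complex.hasSum_re h1
  simp only [Complex.ofReal_re] at h2
  exact ⟨h2, h1.unique (Complex.hasSum_ofReal.2 h2)⟩

theorem hasSum_rpow_zetaShift {s : ℝ} (hs : 0 < s) :
    HasSum (fun n : ℕ ↦ (n : ℝ) ^ (-(1 + s))) (zetaShift s / s) ∧
      riemannZeta ((1 + s : ℝ) : ℂ) = ((zetaShift s / s : ℝ) : ℂ) := by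
  have hre : 1 < (((1 + s : ℝ) : ℂ)).re := by simpa using hs
  have h := LSeriesSummable.hasSum_ofReal (a := fun _ ↦ 1) (by positivity : 1 + s ≠ 0)
    (by simpa using! LSeriesSummable_one_iff.2 hre)
  have h1 : LSeries (fun _ ↦ ((1 : ℝ) : ℂ)) ((1 + s : ℝ) : ℂ) = riemannZeta ((1 + s : ℝ) : ℂ) := by
    rw [← LSeries_one_eq_riemannZeta hre]
    congr 1
  rw [h1] at h
  rw [zetaShift_of_ne_zero hs.ne', mul_div_cancel_left₀ _ hs.ne']
  simpa only [one_mul] using h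

theorem zetaShift_pos {s : ℝ} (hs : 0 < s) : 0 < zetaShift s := by
  have h := (hasSum_rpow_zetaShift hs).1
  have h1 : (1 : ℝ) ≤ zetaShift s / s := by
    simpa using le_hasSum h 1 fun n _ ↦ by positivity
  exact (div_pos_iff_of_pos_right hs).1 (by linarith)

theorem hasDerivAt_log_zetaShift_sub_log {s : ℝ} (hs : 0 < s) :
    HasDerivAt (fun s ↦ Real.log (zetaShift s) - Real.log s)
      (deriv zetaShift s / zetaShift s - 1 / s) s := by
  simpa using! ((analyticAt_zetaShift s).differentiableAt.hasDerivAt.log (zetaShift_pos hs).ne').sub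
    (Real.hasDerivAt_log hs.ne')

theorem hasSum_vonMangoldt_zetaShift {s : ℝ} (hs : 0 < s) :
    HasSum (fun n : ℕ ↦ ArithmeticFunction.vonMangoldt n * (n : ℝ) ^ (-(1 + s)))
      (1 / s - deriv zetaShift s / zetaShift s) ∧
    LSeries (fun n ↦ (ArithmeticFunction.vonMangoldt n : ℂ)) ((1 + s : ℝ) : ℂ) =
      ((1 / s - deriv zetaShift s / zetaShift s : ℝ) : ℂ) := by
  have hre : 1 < (((1 + s : ℝ) : ℂ)).re := by simpa using hs
  have hne : ((1 + s : ℝ) : ℂ) ≠ 1 := by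
    intro h
    rw [h] at hre
    simp at hre
  have h := LSeriesSummable.hasSum_ofReal (by positivity : 1 + s ≠ 0)
    (ArithmeticFunction.LSeriesSummable_vonMangoldt hre)
  have hζ := (hasSum_rpow_zetaShift hs).2
  have hd : HasDerivAt (fun t : ℝ ↦ (riemannZeta ((1 + t : ℝ) : ℂ)).re)
      (deriv riemannZeta ((1 + s : ℝ) : ℂ)).re s := by
    have := ((differentiableAt_riemannZeta hne).hasDerivAt.real_of_complex).comp_const_add 1 s
    simpa using this
  have hd2 : HasDerivAt (fun t : ℝ ↦ (riemannZeta ((1 + t : ℝ) : ℂ)).re)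
      ((deriv zetaShift s * s - zetaShift s * 1) / s ^ 2) s := by
    refine ((analyticAt_zetaShift s).differentiableAt.hasDerivAt.div (hasDerivAt_id s)
      hs.ne').congr_of_eventuallyEq ?_
    filter_upwards [isOpen_ne.mem_nhds hs.ne'] with t ht
    simp only [Pi.div_apply, id]
    rw [zetaShift_of_ne_zero ht, mul_div_cancel_left₀ _ ht]
  have hre' := hd.unique hd2
  have hval : (LSeries (fun n ↦ (ArithmeticFunction.vonMangoldt n : ℂ)) ((1 + s : ℝ) : ℂ)).re =
      1 / s - deriv zetaShift s / zetaShift s := by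
    rw [ArithmeticFunction.LSeries_vonMangoldt_eq_deriv_riemannZeta_div hre, hζ,
      Complex.div_ofReal_re, Complex.neg_re, hre']
    have := (zetaShift_pos hs).ne'
    field_simp
    ring
  rw [hval] at h
  exact h

theorem hasSum_vonMangoldt_div_log_zetaShift {s : ℝ} (hs : 0 < s) :
    HasSum (fun n : ℕ ↦ ArithmeticFunction.vonMangoldt n / Real.log n * (n : ℝ) ^ (-(1 + s)))
      (Real.log (zetaShift s) - Real.log s) := by
  set f : ℕ → ℂ := fun n ↦ ((ArithmeticFunction.vonMangoldt n / Real.log n : ℝ) : ℂ) with hf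
  have hlogMul : LSeries.logMul f = fun n ↦ (ArithmeticFunction.vonMangoldt n : ℂ) := by
    ext n
    simp only [LSeries.logMul, hf]
    rw [← Complex.natCast_log, ← Complex.ofReal_mul]
    congr 1
    rcases eq_or_ne (Real.log n) 0 with h | h
    · have : n = 0 ∨ n = 1 := by
        rcases Real.log_eq_zero.1 h with h | h | h
        · left; exact_mod_cast h
        · right; exact_mod_cast h
        · exfalso; linarith [(Nat.cast_nonneg n : (0 : ℝ) ≤ n)]
      rcases this with rfl | rfl <;> simp
    · field_simp
  have habs : LSeries.abscissaOfAbsConv f ≤ 1 := by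
    rw [← LSeries.abscissaOfAbsConv_logMul, hlogMul]
    refine LSeries.abscissaOfAbsConv_le_of_forall_lt_LSeriesSummable fun y hy ↦
      ArithmeticFunction.LSeriesSummable_vonMangoldt (by simpa using hy)
  have hlt : ∀ t : ℝ, 0 < t → LSeries.abscissaOfAbsConv f < (((1 + t : ℝ) : ℂ)).re := by
    intro t ht
    refine habs.trans_lt ?_
    rw [Complex.ofReal_re]
    exact_mod_cast (by linarith : (1 : ℝ) < 1 + t)
  have hder : ∀ t : ℝ, 0 < t → HasDerivAt (fun t : ℝ ↦ (LSeries f ((1 + t : ℝ) : ℂ)).re)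
      (deriv zetaShift t / zetaShift t - 1 / t) t := by
    intro t ht
    have h1 := LSeries_hasDerivAt (hlt t ht)
    rw [hlogMul, (hasSum_vonMangoldt_zetaShift ht).2] at h1
    have := h1.real_of_complex.comp_const_add 1 t
    simpa [← Complex.ofReal_neg] using this
  have hconst : ∀ t : ℝ, 0 < t → (LSeries f ((1 + t : ℝ) : ℂ)).re -
      (Real.log (zetaShift t) - Real.log t) =
      (LSeries f ((1 + s : ℝ) : ℂ)).re - (Real.log (zetaShift s) - Real.log s) := by
    intro t ht
    refine isOpen_Ioi.is_const_of_deriv_eq_zero (s := Ioi (0 : ℝ)) isPreconnected_Ioi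
      (f := fun t ↦ (LSeries f ((1 + t : ℝ) : ℂ)).re - (Real.log (zetaShift t) - Real.log t))
      ?_ ?_ ht hs
    · exact fun y hy ↦ ((hder y hy).sub
        (hasDerivAt_log_zetaShift_sub_log hy)).differentiableAt.differentiableWithinAt
    · intro y hy
      simpa using! ((hder y hy).sub (hasDerivAt_log_zetaShift_sub_log hy)).deriv
  have hshift : Tendsto (fun t : ℝ ↦ 1 + t) atTop atTop := tendsto_atTop_add_const_left _ _ tendsto_id
  have hlim1 : Tendsto (fun t : ℝ ↦ (LSeries f ((1 + t : ℝ) : ℂ)).re) atTop (𝓝 0) := by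
    have h := (LSeries.tendsto_atTop (f := f) (habs.trans_lt (EReal.coe_lt_top 1))).comp hshift
    have := (Complex.continuous_re.tendsto _).comp h
    simpa [hf, Function.comp_def] using this
  have hlim2 : Tendsto (fun t : ℝ ↦ Real.log (zetaShift t) - Real.log t) atTop (𝓝 0) := by
    have h := (LSeries.tendsto_atTop (f := 1) (by
      rw [LSeries.abscissaOfAbsConv_one]; exact EReal.coe_lt_top 1)).comp hshift
    have h2 := ((Complex.continuous_re.tendsto _).comp h)
    simp only [Pi.one_apply, Complex.one_re] at h2
    have h3 := h2.log one_ne_zero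
    rw [Real.log_one] at h3
    refine h3.congr' ?_
    filter_upwards [eventually_gt_atTop 0] with t ht
    simp only [Function.comp]
    rw [LSeries_one_eq_riemannZeta (by simpa using ht), (hasSum_rpow_zetaShift ht).2,
      Complex.ofReal_re, Real.log_div (zetaShift_pos ht).ne' ht.ne']
  have h0 : (LSeries f ((1 + s : ℝ) : ℂ)).re = Real.log (zetaShift s) - Real.log s := by
    have h := hlim1.sub hlim2
    rw [sub_zero] at h
    have h' := h.congr' (by
      filter_upwards [eventually_gt_atTop 0] with t ht using hconst t ht)
    have := tendsto_nhds_unique tendsto_const_nhds h'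
    linarith
  rw [← h0]
  exact (LSeriesSummable.hasSum_ofReal (by positivity)
    (LSeriesSummable_of_abscissaOfAbsConv_lt_re (hlt s hs))).1

theorem integral_sum_Ioc_floor_exp_mul {a : ℕ → ℝ} (ha : ∀ n, 0 ≤ a n) (ha0 : a 0 = 0)
    {h : ℝ → ℝ} (hh : ∀ u, 0 < u → 0 ≤ h u) (hint : IntegrableOn h (Ioi 0)) {S : ℝ} (hS0 : S ≠ 0)
    (hS : HasSum (fun n : ℕ ↦ a n * ∫ u in Ioi (Real.log n), h u) S) :
    IntegrableOn (fun u ↦ (∑ n ∈ Finset.Ioc 0 ⌊Real.exp u⌋₊, a n) * h u) (Ioi 0) ∧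
      ∫ u in Ioi 0, (∑ n ∈ Finset.Ioc 0 ⌊Real.exp u⌋₊, a n) * h u = S := by
  set F : ℕ → ℝ → ℝ := fun n ↦ (Ici (Real.log n)).indicator (fun u ↦ a n * h u) with hF
  have hFint : ∀ n, Integrable (F n) (volume.restrict (Ioi 0)) := fun n ↦
    (hint.const_mul _).indicator measurableSet_Ici
  have hFval : ∀ n, ∫ u in Ioi 0, F n u = a n * ∫ u in Ioi (Real.log n), h u := by
    intro n
    have hn : (0 : ℝ) ≤ Real.log n := Real.log_natCast_nonneg n
    rw [hF, setIntegral_indicator measurableSet_Ici, integral_const_mul]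
    congr 1
    refine setIntegral_congr_set ?_
    have h1 : (Ioi (0 : ℝ) ∩ Ici (Real.log n) : Set ℝ) =ᵐ[volume] (Ioi 0 ∩ Ioi (Real.log n) : Set ℝ) :=
      (ae_eq_refl _).inter Ioi_ae_eq_Ici.symm
    rwa [Ioi_inter_Ioi, max_eq_right hn] at h1
  have hFnn : ∀ n, ∀ u ∈ Ioi (0 : ℝ), 0 ≤ F n u := fun n u hu ↦
    indicator_apply_nonneg fun _ ↦ mul_nonneg (ha n) (hh u hu)
  have hsumm : Summable fun n ↦ ∫ u in Ioi 0, ‖F n u‖ := by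
    refine hS.summable.congr fun n ↦ ?_
    rw [← hFval]
    exact setIntegral_congr_fun measurableSet_Ioi fun u hu ↦ (Real.norm_of_nonneg (hFnn n u hu)).symm
  have H := hasSum_integral_of_summable_integral_norm hFint hsumm
  simp only [hFval] at H
  have hval : ∫ u in Ioi 0, (∑ n ∈ Finset.Ioc 0 ⌊Real.exp u⌋₊, a n) * h u = S := by
    rw [← H.unique hS]
    refine integral_congr_ae (Eventually.of_forall fun u ↦ ?_)
    simp only
    rw [tsum_eq_sum (s := Finset.Ioc 0 ⌊Real.exp u⌋₊), Finset.sum_mul]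
    · refine Finset.sum_congr rfl fun n hn ↦ ?_
      rw [Finset.mem_Ioc, Nat.le_floor_iff (Real.exp_nonneg _)] at hn
      have hn0 : (0 : ℝ) < n := by exact_mod_cast hn.1
      have hmem : u ∈ Ici (Real.log n) := mem_Ici.2 ((Real.log_le_iff_le_exp hn0).2 hn.2)
      simp only [hF, indicator_of_mem hmem]
    · intro n hn
      rcases Nat.eq_zero_or_pos n with rfl | hn0
      · simp [hF, ha0]
      · refine indicator_of_notMem (fun hmem ↦ hn ?_) _
        rw [Finset.mem_Ioc, Nat.le_floor_iff (Real.exp_nonneg _)]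
        exact ⟨hn0, (Real.log_le_iff_le_exp (by exact_mod_cast hn0)).1 hmem⟩
  exact ⟨Integrable.of_integral_ne_zero (by rwa [hval]), hval⟩

theorem integral_Ioi_exp_neg_mul {s : ℝ} (hs : 0 < s) (c : ℝ) :
    IntegrableOn (fun u ↦ Real.exp (-s * u)) (Ioi c) ∧
      ∫ u in Ioi c, Real.exp (-s * u) = Real.exp (-s * c) / s := by
  refine ⟨integrableOn_exp_mul_Ioi (by linarith) c, ?_⟩
  rw [integral_exp_mul_Ioi (by linarith) c]
  field_simp

theorem integral_Ioi_mul_exp_neg_mul {s : ℝ} (hs : 0 < s) {c : ℝ} (hc : 0 ≤ c) :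
    IntegrableOn (fun u ↦ u * Real.exp (-s * u)) (Ioi c) ∧
      ∫ u in Ioi c, u * Real.exp (-s * u) = (c / s + 1 / s ^ 2) * Real.exp (-s * c) := by
  have hd : ∀ x ∈ Ici c, HasDerivAt (fun u ↦ -((u / s + 1 / s ^ 2) * Real.exp (-s * u)))
      (x * Real.exp (-s * x)) x := by
    intro x _
    have h1 : HasDerivAt (fun u : ℝ ↦ -s * u) (-s) x := by
      simpa using (hasDerivAt_id x).const_mul (-s)
    have h2 : HasDerivAt (fun u : ℝ ↦ u / s + 1 / s ^ 2) (1 / s) x :=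
      ((hasDerivAt_id x).div_const s).add_const _
    convert! (h2.mul h1.exp).neg using 1
    field_simp
    ring
  have ht : Tendsto (fun u ↦ -((u / s + 1 / s ^ 2) * Real.exp (-s * u))) atTop (𝓝 0) := by
    have h1 : Tendsto (fun u : ℝ ↦ u * Real.exp (-s * u)) atTop (𝓝 0) := by
      have := (((Real.tendsto_pow_mul_exp_neg_atTop_nhds_zero 1).comp
        (tendsto_id.const_mul_atTop hs)).const_mul s⁻¹)
      rw [mul_zero] at this
      refine this.congr fun u ↦ ?_
      simp only [Function.comp, id, pow_one, neg_mul]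
      field_simp
    have h2 : Tendsto (fun u : ℝ ↦ Real.exp (-s * u)) atTop (𝓝 0) :=
      Real.tendsto_exp_atBot.comp (tendsto_id.const_mul_atTop_of_neg (by linarith))
    have := ((h1.const_mul (1 / s)).add (h2.const_mul (1 / s ^ 2))).neg
    simp only [mul_zero, add_zero, neg_zero] at this
    refine this.congr fun u ↦ ?_
    ring
  have hnn : ∀ x ∈ Ioi c, 0 ≤ x * Real.exp (-s * x) := fun x hx ↦
    mul_nonneg (hc.trans (le_of_lt hx)) (Real.exp_nonneg _)
  refine ⟨integrableOn_Ioi_deriv_of_nonneg' hd hnn ht, ?_⟩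
  rw [integral_Ioi_of_hasDerivAt_of_nonneg' hd hnn ht]
  ring

theorem exp_neg_mul_log_natCast {n : ℕ} (hn : n ≠ 0) (s : ℝ) :
    Real.exp (-s * Real.log n) = (n : ℝ) ^ (-s) := by
  rw [Real.rpow_def_of_pos (by positivity), mul_comm]

theorem laplace_floor_exp {s : ℝ} (hs : 0 < s) :
    IntegrableOn (fun u ↦ (⌊Real.exp u⌋₊ : ℝ) * Real.exp (-(1 + s) * u)) (Ioi 0) ∧
      ∫ u in Ioi 0, (⌊Real.exp u⌋₊ : ℝ) * Real.exp (-(1 + s) * u) =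
        zetaShift s / s / (1 + s) := by
  have hs1 : 0 < 1 + s := by linarith
  have h := integral_sum_Ioc_floor_exp_mul (a := fun n ↦ if n = 0 then 0 else 1)
    (h := fun u ↦ Real.exp (-(1 + s) * u)) (S := zetaShift s / s / (1 + s))
    (fun n ↦ by split_ifs <;> norm_num) (by simp) (fun u _ ↦ (Real.exp_nonneg _))
    (integral_Ioi_exp_neg_mul hs1 0).1 (by have := zetaShift_pos hs; positivity) (by
      refine ((hasSum_rpow_zetaShift hs).1.div_const (1 + s)).congr_fun fun n ↦ ?_
      rw [(integral_Ioi_exp_neg_mul hs1 _).2]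
      rcases eq_or_ne n 0 with rfl | hn
      · rw [Nat.cast_zero, Real.zero_rpow (by linarith)]; simp
      · rw [exp_neg_mul_log_natCast hn, if_neg hn, one_mul])
  have hsum : ∀ u : ℝ, ∑ n ∈ Finset.Ioc 0 ⌊Real.exp u⌋₊, (if n = 0 then (0 : ℝ) else 1) =
      (⌊Real.exp u⌋₊ : ℝ) := by
    intro u
    rw [Finset.sum_congr rfl (g := fun _ ↦ (1 : ℝ))
      fun n hn ↦ if_neg (Finset.mem_Ioc.1 hn).1.ne']
    simp
  simpa only [hsum] using h

theorem laplace_psi_exp {s : ℝ} (hs : 0 < s) :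
    IntegrableOn (fun u ↦ Chebyshev.psi (Real.exp u) * Real.exp (-(1 + s) * u)) (Ioi 0) ∧
      ∫ u in Ioi 0, Chebyshev.psi (Real.exp u) * Real.exp (-(1 + s) * u) =
        (1 / s - deriv zetaShift s / zetaShift s) / (1 + s) := by
  have hs1 : 0 < 1 + s := by linarith
  have hsum := (hasSum_vonMangoldt_zetaShift hs).1
  have hpos : 0 < 1 / s - deriv zetaShift s / zetaShift s := by
    refine (mul_pos (ArithmeticFunction.vonMangoldt_pos_iff.2 Nat.prime_two.isPrimePow)
      (by positivity : (0 : ℝ) < ((2 : ℕ) : ℝ) ^ (-(1 + s)))).trans_le (le_hasSum hsum 2 fun n _ ↦ ?_)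
    have := @ArithmeticFunction.vonMangoldt_nonneg n
    positivity
  exact integral_sum_Ioc_floor_exp_mul (a := fun n ↦ ArithmeticFunction.vonMangoldt n)
    (h := fun u ↦ Real.exp (-(1 + s) * u))
    (fun n ↦ ArithmeticFunction.vonMangoldt_nonneg) (by simp) (fun u _ ↦ (Real.exp_nonneg _))
    (integral_Ioi_exp_neg_mul hs1 0).1 (by positivity) (by
      refine (hsum.div_const (1 + s)).congr_fun fun n ↦ ?_
      rw [(integral_Ioi_exp_neg_mul hs1 _).2]
      rcases eq_or_ne n 0 with rfl | hn
      · simp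
      · rw [exp_neg_mul_log_natCast hn, mul_div_assoc])

/-- The sum of `Λ(n) / (n log n)` over `n ≤ x`. -/
noncomputable def primePowerSum (x : ℝ) : ℝ :=
  ∑ n ∈ Finset.Ioc 0 ⌊x⌋₊, ArithmeticFunction.vonMangoldt n / (n * Real.log n)

theorem vonMangoldt_div_mul_log_nonneg (n : ℕ) :
    0 ≤ ArithmeticFunction.vonMangoldt n / (n * Real.log n) :=
  div_nonneg ArithmeticFunction.vonMangoldt_nonneg
    (mul_nonneg (Nat.cast_nonneg n) (Real.log_natCast_nonneg n))

theorem laplace_mul_primePowerSum_exp {s : ℝ} (hs : 0 < s) :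
    IntegrableOn (fun u ↦ primePowerSum (Real.exp u) * (u * Real.exp (-s * u))) (Ioi 0) ∧
      ∫ u in Ioi 0, primePowerSum (Real.exp u) * (u * Real.exp (-s * u)) =
        (1 / s - deriv zetaShift s / zetaShift s) / s +
          (Real.log (zetaShift s) - Real.log s) / s ^ 2 := by
  have hsum1 := (hasSum_vonMangoldt_zetaShift hs).1
  have hsum2 := hasSum_vonMangoldt_div_log_zetaShift hs
  have hpos1 : 0 < 1 / s - deriv zetaShift s / zetaShift s := by
    refine (mul_pos (ArithmeticFunction.vonMangoldt_pos_iff.2 Nat.prime_two.isPrimePow)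
      (by positivity : (0 : ℝ) < ((2 : ℕ) : ℝ) ^ (-(1 + s)))).trans_le (le_hasSum hsum1 2 fun n _ ↦ ?_)
    have := @ArithmeticFunction.vonMangoldt_nonneg n
    positivity
  have hpos2 : 0 ≤ Real.log (zetaShift s) - Real.log s := hsum2.nonneg fun n ↦
    mul_nonneg (div_nonneg ArithmeticFunction.vonMangoldt_nonneg (Real.log_natCast_nonneg n))
      (by positivity)
  refine integral_sum_Ioc_floor_exp_mul (h := fun u ↦ u * Real.exp (-s * u))
    vonMangoldt_div_mul_log_nonneg (by simp) (fun u hu ↦ mul_nonneg hu.le (Real.exp_nonneg _))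
    (integral_Ioi_mul_exp_neg_mul hs le_rfl).1 (by positivity) ?_
  refine ((hsum1.div_const s).add (hsum2.div_const (s ^ 2))).congr_fun fun n ↦ ?_
  rw [(integral_Ioi_mul_exp_neg_mul hs (Real.log_natCast_nonneg n)).2]
  rcases eq_or_ne n 0 with rfl | hn
  · simp
  rcases eq_or_ne n 1 with rfl | hn1
  · simp
  have hn0 : (0 : ℝ) < n := by positivity
  have hl : 0 < Real.log n := Real.log_pos (by exact_mod_cast (by omega : 1 < n))
  rw [exp_neg_mul_log_natCast hn, neg_add, Real.rpow_add hn0, Real.rpow_neg_one]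
  field_simp

theorem laplace_mul_log {s : ℝ} (hs : 0 < s) :
    IntegrableOn (fun u ↦ u * Real.log u * Real.exp (-s * u)) (Ioi 0) ∧
      ∫ u in Ioi 0, u * Real.log u * Real.exp (-s * u) =
        (1 - Real.eulerMascheroniConstant - Real.log s) / s ^ 2 := by
  have hΓ : ∫ t in Ioi (0 : ℝ), t * Real.log t * Real.exp (-t) =
      1 - Real.eulerMascheroniConstant := by
    have h1 := Complex.hasDerivAt_GammaIntegral (s := 2) (by simp)
    have h2 : HasDerivAt Complex.Gamma
        (∫ t : ℝ in Ioi 0, (t : ℂ) ^ ((2 : ℂ) - 1) * (Real.log t * Real.exp (-t))) 2 := by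
      refine h1.congr_of_eventuallyEq ?_
      filter_upwards [(isOpen_lt continuous_const Complex.continuous_re).mem_nhds
        (show (0 : ℝ) < (2 : ℂ).re by simp)] with z hz using Complex.Gamma_eq_integral hz
    have h3 := Complex.hasDerivAt_Gamma_nat 1
    norm_num at h3
    have h4 := h2.unique h3
    have h5 : ∫ t : ℝ in Ioi 0, (t : ℂ) ^ ((2 : ℂ) - 1) * (Real.log t * Real.exp (-t)) =
        ∫ t : ℝ in Ioi 0, ((t * Real.log t * Real.exp (-t) : ℝ) : ℂ) := by
      refine integral_congr_ae (Eventually.of_forall fun t ↦ ?_)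
      norm_num
      ring
    rw [h5, integral_complex_ofReal] at h4
    have h6 : ((∫ t in Ioi (0 : ℝ), t * Real.log t * Real.exp (-t) : ℝ) : ℂ) =
        ((1 - Real.eulerMascheroniConstant : ℝ) : ℂ) := by
      rw [h4]; push_cast; ring
    exact_mod_cast h6
  have hγ := Real.eulerMascheroniConstant_lt_two_thirds
  have hI : IntegrableOn (fun t ↦ t * Real.log t * Real.exp (-t)) (Ioi 0) :=
    Integrable.of_integral_ne_zero (by rw [hΓ]; linarith)
  have hI' : IntegrableOn (fun u ↦ s * u * Real.log (s * u) * Real.exp (-(s * u))) (Ioi 0) := by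
    have := (integrableOn_Ioi_comp_mul_left_iff (fun t ↦ t * Real.log t * Real.exp (-t)) 0 hs).2
      (by simpa using hI)
    exact this
  have hV := integral_comp_mul_left_Ioi (fun t ↦ t * Real.log t * Real.exp (-t)) 0 hs
  rw [mul_zero, hΓ, smul_eq_mul] at hV
  obtain ⟨hJ, hJV⟩ := integral_Ioi_mul_exp_neg_mul hs (le_refl (0 : ℝ))
  have hcongr : EqOn (fun u ↦ u * Real.log u * Real.exp (-s * u))
      (fun u ↦ s⁻¹ * (s * u * Real.log (s * u) * Real.exp (-(s * u))) -
        Real.log s * (u * Real.exp (-s * u))) (Ioi 0) := by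
    intro u hu
    simp only
    rw [Real.log_mul hs.ne' (ne_of_gt hu), ← neg_mul]
    field_simp
    ring
  constructor
  · rw [integrableOn_congr_fun hcongr measurableSet_Ioi]
    exact (hI'.const_mul _).sub (hJ.const_mul _)
  · rw [setIntegral_congr_fun measurableSet_Ioi hcongr,
      integral_sub (hI'.const_mul _) (hJ.const_mul _), integral_const_mul, integral_const_mul, hV, hJV]
    simp
    field_simp

theorem AnalyticAt.dslope_of_analyticAt {f : ℝ → ℝ} {a s : ℝ} (ha : AnalyticAt ℝ f a)
    (hs : AnalyticAt ℝ f s) : AnalyticAt ℝ (dslope f a) s := by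
  rcases eq_or_ne s a with rfl | hne
  · obtain ⟨p, hp⟩ := ha
    exact ⟨_, hp.has_fpower_series_dslope_fslope⟩
  · have h : AnalyticAt ℝ (fun t ↦ (f t - f a) / (t - a)) s :=
      (hs.sub analyticAt_const).div (analyticAt_id.sub analyticAt_const) (sub_ne_zero.2 hne)
    refine h.congr ?_
    filter_upwards [isOpen_ne.mem_nhds hne] with t ht
    rw [dslope_of_ne _ ht, slope_def_field]

theorem zetaShift_pos_of_neg_one_lt {s : ℝ} (hs : -1 < s) : 0 < zetaShift s := by
  rcases lt_trichotomy s 0 with hneg | rfl | hpos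
  · have hD : ∀ t, AnalyticAt ℝ (fun t ↦ 1 + t - zetaShift t) t := fun t ↦
      (analyticAt_const.add analyticAt_id).sub (analyticAt_zetaShift t)
    have hslope : ∀ t ≠ 0, dslope (fun t ↦ 1 + t - zetaShift t) 0 t =
        (1 + t - zetaShift t) / t := by
      intro t ht
      rw [dslope_of_ne _ ht, slope_def_field]
      simp [zetaShift_zero]
    have hcongr : ∀ t : ℝ, EqOn (fun u ↦ (1 - (⌊Real.exp u⌋₊ : ℝ) * Real.exp (-u)) * Real.exp (-t * u))
        (fun u ↦ Real.exp (-t * u) - (⌊Real.exp u⌋₊ : ℝ) * Real.exp (-(1 + t) * u)) (Ioi 0) := by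
      intro t u _
      simp only
      rw [show -(1 + t) * u = -u + -t * u by ring, Real.exp_add]
      ring
    have key := laplace_extension_nonneg (a := 0) (b := -1)
      (f := fun u ↦ 1 - (⌊Real.exp u⌋₊ : ℝ) * Real.exp (-u))
      (G := fun t ↦ dslope (fun t ↦ 1 + t - zetaShift t) 0 t / (1 + t))
      (by fun_prop) (fun u _ ↦ by
        have h1 := Nat.floor_le (Real.exp_nonneg u)
        have h2 : (⌊Real.exp u⌋₊ : ℝ) * Real.exp (-u) ≤ Real.exp u * Real.exp (-u) := by gcongr
        rw [← Real.exp_add, add_neg_cancel, Real.exp_zero] at h2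
        linarith)
      (fun t ht ↦ ((hD 0).dslope_of_analyticAt (hD t)).div
        (analyticAt_const.add analyticAt_id) (by
          change 1 + t ≠ 0
          linarith [mem_Ioi.1 ht]))
      (fun t ht ↦ by
        rw [integrableOn_congr_fun (hcongr t) measurableSet_Ioi]
        exact (integral_Ioi_exp_neg_mul ht 0).1.sub (laplace_floor_exp ht).1)
      (fun t ht ↦ by
        rw [setIntegral_congr_fun measurableSet_Ioi (hcongr t),
          integral_sub (integral_Ioi_exp_neg_mul ht 0).1 (laplace_floor_exp ht).1,
          (integral_Ioi_exp_neg_mul ht 0).2, (laplace_floor_exp ht).2, hslope t ht.ne']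
        have : 1 + t ≠ 0 := by linarith
        simp only [mul_zero, Real.exp_zero]
        field_simp)
      s hs
    simp only [hslope s hneg.ne] at key
    have h1 : 0 ≤ (1 + s - zetaShift s) / s := by
      have := mul_nonneg key (by linarith : 0 ≤ 1 + s)
      rwa [div_mul_cancel₀ _ (by linarith : 1 + s ≠ 0)] at this
    have h2 : 1 + s - zetaShift s ≤ 0 := by
      have := mul_nonpos_of_nonneg_of_nonpos h1 hneg.le
      rwa [div_mul_cancel₀ _ hneg.ne] at this
    linarith
  · simp [zetaShift_zero]
  · exact zetaShift_pos hpos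

/-- The function `log (s ζ(1 + s)) / s`, extended analytically to `s = 0`. -/
noncomputable def logZetaQuotient : ℝ → ℝ := dslope (fun t ↦ Real.log (zetaShift t)) 0

theorem analyticAt_logZetaQuotient {s : ℝ} (hs : -1 < s) : AnalyticAt ℝ logZetaQuotient s := by
  have h : ∀ t, -1 < t → AnalyticAt ℝ (fun t ↦ Real.log (zetaShift t)) t := fun t ht ↦
    (analyticAt_zetaShift t).log (zetaShift_pos_of_neg_one_lt ht)
  exact (h 0 (by norm_num)).dslope_of_analyticAt (h s hs)

theorem logZetaQuotient_of_pos {s : ℝ} (hs : 0 < s) :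
    logZetaQuotient s = Real.log (zetaShift s) / s ∧
      deriv logZetaQuotient s =
        (deriv zetaShift s / zetaShift s * s - Real.log (zetaShift s)) / s ^ 2 := by
  have h : ∀ t, 0 < t → logZetaQuotient t = Real.log (zetaShift t) / t := fun t ht ↦ by
    rw [logZetaQuotient, dslope_of_ne _ ht.ne', slope_def_field]
    simp [zetaShift_zero]
  refine ⟨h s hs, HasDerivAt.deriv ?_⟩
  have hd := (((analyticAt_zetaShift s).differentiableAt.hasDerivAt.log
    (zetaShift_pos hs).ne').div (hasDerivAt_id s) hs.ne')
  simp only [id, mul_one] at hd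
  refine hd.congr_of_eventuallyEq ?_
  filter_upwards [Ioi_mem_nhds hs] with t ht using h t ht

/-- With `x = e^u`, this is `log x` times the error in Mertens' theorem for prime powers, minus
the relative error `(ψ(x) - x) / x`. -/
noncomputable def mertensPsiGap (u : ℝ) : ℝ :=
  u * (primePowerSum (Real.exp u) - Real.eulerMascheroniConstant - Real.log u) -
    (Chebyshev.psi (Real.exp u) - Real.exp u) * Real.exp (-u)

theorem measurable_mertensPsiGap : Measurable mertensPsiGap := by
  have h1 : Measurable fun u ↦ primePowerSum (Real.exp u) :=
    (measurable_from_nat (f := fun m ↦ ∑ n ∈ Finset.Ioc 0 m,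
      ArithmeticFunction.vonMangoldt n / (n * Real.log n))).comp
        (Nat.measurable_floor.comp Real.measurable_exp)
  have h2 : Measurable fun u ↦ Chebyshev.psi (Real.exp u) :=
    Chebyshev.psi_mono.measurable.comp Real.measurable_exp
  unfold mertensPsiGap
  fun_prop

theorem laplace_mertensPsiGap {s : ℝ} (hs : 0 < s) :
    IntegrableOn (fun u ↦ mertensPsiGap u * Real.exp (-s * u)) (Ioi 0) ∧
      ∫ u in Ioi 0, mertensPsiGap u * Real.exp (-s * u) =
        (logZetaQuotient s - deriv logZetaQuotient s + 1) / (1 + s) := by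
  obtain ⟨i1, v1⟩ := laplace_mul_primePowerSum_exp hs
  obtain ⟨i2, v2⟩ := integral_Ioi_mul_exp_neg_mul hs (le_refl (0 : ℝ))
  obtain ⟨i3, v3⟩ := laplace_mul_log hs
  obtain ⟨i4, v4⟩ := laplace_psi_exp hs
  obtain ⟨i5, v5⟩ := integral_Ioi_exp_neg_mul hs 0
  have hcongr : (fun u ↦ mertensPsiGap u * Real.exp (-s * u)) = fun u ↦
      primePowerSum (Real.exp u) * (u * Real.exp (-s * u)) -
      Real.eulerMascheroniConstant * (u * Real.exp (-s * u)) - u * Real.log u * Real.exp (-s * u) -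
      Chebyshev.psi (Real.exp u) * Real.exp (-(1 + s) * u) + Real.exp (-s * u) := by
    ext u
    have h1 : Real.exp u * Real.exp (-u) = 1 := by rw [← Real.exp_add]; simp
    rw [show -(1 + s) * u = -u + -s * u by ring, Real.exp_add, mertensPsiGap]
    linear_combination Real.exp (-s * u) * h1
  have j1 := i1.sub (i2.const_mul Real.eulerMascheroniConstant)
  have j2 := j1.sub i3
  have j3 := j2.sub i4
  rw [hcongr]
  refine ⟨j3.add i5, ?_⟩
  rw [integral_add (by exact j3) i5, integral_sub (by exact j2) i4, integral_sub (by exact j1) i3,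
    integral_sub i1 (by exact i2.const_mul _), integral_const_mul, v1, v2, v3, v4, v5,
    (logZetaQuotient_of_pos hs).1, (logZetaQuotient_of_pos hs).2]
  have hz := (zetaShift_pos hs).ne'
  have hs1 : 1 + s ≠ 0 := by linarith
  simp only [mul_zero, Real.exp_zero]
  field_simp
  ring

theorem mertensPsiGap_le_of_le {u U : ℝ} (hu : 0 < u) (hU : u ≤ U) :
    mertensPsiGap u ≤ U * primePowerSum (Real.exp U) + 2 := by
  have h1 : primePowerSum (Real.exp u) ≤ primePowerSum (Real.exp U) := by
    unfold primePowerSum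
    refine Finset.sum_le_sum_of_subset_of_nonneg (Finset.Ioc_subset_Ioc_right ?_)
      fun n _ _ ↦ vonMangoldt_div_mul_log_nonneg n
    gcongr
  have h0 : 0 ≤ primePowerSum (Real.exp u) :=
    Finset.sum_nonneg fun n _ ↦ vonMangoldt_div_mul_log_nonneg n
  have h2 : u * primePowerSum (Real.exp u) ≤ U * primePowerSum (Real.exp U) := by
    gcongr
    linarith
  have h3 : 0 ≤ u * Real.eulerMascheroniConstant :=
    mul_nonneg hu.le (by linarith [Real.one_half_lt_eulerMascheroniConstant])
  have h4 : -(u * Real.log u) ≤ 1 := by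
    have := Real.one_sub_inv_le_log_of_pos hu
    have h5 : u * (1 - u⁻¹) ≤ u * Real.log u := by gcongr
    rw [mul_sub, mul_inv_cancel₀ hu.ne'] at h5
    linarith
  have h5 : 0 ≤ Chebyshev.psi (Real.exp u) * Real.exp (-u) :=
    mul_nonneg (Chebyshev.psi_nonneg _) (Real.exp_nonneg _)
  have h6 : Real.exp u * Real.exp (-u) = 1 := by rw [← Real.exp_add]; simp
  unfold mertensPsiGap
  nlinarith

/-- The one-sided oscillation result: `mertensPsiGap u` is not bounded above by a negative multiple of
`e^{-u/2}` for all large `u`. -/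
theorem not_eventually_mertensPsiGap_le {c : ℝ} (hc : 0 < c) :
    ¬ ∀ᶠ u in atTop, mertensPsiGap u ≤ -c * Real.exp (-(1 / 2) * u) := by
  intro hev
  obtain ⟨U, hU⟩ := eventually_atTop.1 hev
  wlog hU0 : 0 < U generalizing U
  · exact this (max U 1) (fun u hu ↦ hU u ((le_max_left _ _).trans hu)) (by positivity)
  set C : ℝ := (U * primePowerSum (Real.exp U) + 2 + c) * Real.exp (2 * U) with hC
  have hP : 0 ≤ primePowerSum (Real.exp U) :=
    Finset.sum_nonneg fun n _ ↦ vonMangoldt_div_mul_log_nonneg n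
  have hC0 : 0 ≤ C := by positivity
  set M : ℝ → ℝ := fun s ↦ (logZetaQuotient s - deriv logZetaQuotient s + 1) / (1 + s) with hM
  have hMan : ∀ s, -1 < s → AnalyticAt ℝ M s := fun s hs ↦
    (((analyticAt_logZetaQuotient hs).sub (analyticAt_logZetaQuotient hs).deriv).add
      analyticAt_const).div (analyticAt_const.add analyticAt_id) (by change 1 + s ≠ 0; linarith)
  have hcongr : ∀ t : ℝ, (fun u ↦ (C * Real.exp (-2 * u) - c * Real.exp (-(1 / 2) * u) -
      mertensPsiGap u) * Real.exp (-t * u)) = fun u ↦ C * Real.exp (-(t + 2) * u) -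
        c * Real.exp (-(t + 1 / 2) * u) - mertensPsiGap u * Real.exp (-t * u) := by
    intro t
    ext u
    rw [show -(t + 2) * u = -2 * u + -t * u by ring,
      show -(t + 1 / 2) * u = -(1 / 2) * u + -t * u by ring, Real.exp_add, Real.exp_add]
    ring
  have hmeas := measurable_mertensPsiGap
  have key := laplace_extension_nonneg (a := 0) (b := -(1 / 2))
    (f := fun u ↦ C * Real.exp (-2 * u) - c * Real.exp (-(1 / 2) * u) - mertensPsiGap u)
    (G := fun s ↦ C * (1 / (s + 2)) - c * (1 / (s + 1 / 2)) - M s) (by fun_prop)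
    (fun u hu ↦ by
      rcases le_total U u with h | h
      · have h1 := hU u h
        have h2 : 0 ≤ C * Real.exp (-2 * u) := by positivity
        linarith
      · have h1 := mertensPsiGap_le_of_le hu h
        have h2 : (U * primePowerSum (Real.exp U) + 2 + c) * 1 ≤ C * Real.exp (-2 * u) := by
          rw [hC, mul_assoc, ← Real.exp_add]
          gcongr
          exact Real.one_le_exp (by linarith)
        have h3 : c * Real.exp (-(1 / 2) * u) ≤ c * 1 := by
          gcongr
          exact Real.exp_le_one_iff.2 (by linarith)
        linarith)
    (fun s hs ↦ by
      have hs' : -(1 / 2) < s := hs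
      exact ((analyticAt_const.mul (analyticAt_const.div (analyticAt_id.add analyticAt_const)
        (show s + 2 ≠ 0 by linarith))).sub (analyticAt_const.mul (analyticAt_const.div
          (analyticAt_id.add analyticAt_const) (show s + 1 / 2 ≠ 0 by linarith)))).sub
            (hMan s (by linarith)))
    (fun t ht ↦ by
      rw [hcongr]
      exact (((integral_Ioi_exp_neg_mul (by linarith : 0 < t + 2) 0).1.const_mul _).sub
        ((integral_Ioi_exp_neg_mul (by linarith : 0 < t + 1 / 2) 0).1.const_mul _)).sub
          (laplace_mertensPsiGap ht).1)
    (fun t ht ↦ by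
      obtain ⟨i1, v1⟩ := integral_Ioi_exp_neg_mul (by linarith : 0 < t + 2) 0
      obtain ⟨i2, v2⟩ := integral_Ioi_exp_neg_mul (by linarith : 0 < t + 1 / 2) 0
      rw [hcongr, integral_sub (by exact (i1.const_mul C).sub (i2.const_mul c))
        (laplace_mertensPsiGap ht).1, integral_sub (i1.const_mul C) (i2.const_mul c),
        integral_const_mul, integral_const_mul, v1, v2, (laplace_mertensPsiGap ht).2]
      simp [hM])
  have hcont : ContinuousAt (fun s : ℝ ↦ (s + 1 / 2) * (C * (1 / (s + 2)) - M s) - c)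
      (-(1 / 2)) := by
    have h1 := (hMan (-(1 / 2)) (by norm_num)).continuousAt
    have h2 : ContinuousAt (fun s : ℝ ↦ 1 / (s + 2)) (-(1 / 2)) :=
      continuousAt_const.div (by fun_prop) (by norm_num)
    fun_prop
  have hlim := hcont.tendsto.mono_left (nhdsWithin_le_nhds (s := Ioi (-(1 / 2))))
  have hge : 0 ≤ (-(1 / 2) + 1 / 2) * (C * (1 / (-(1 / 2) + 2)) - M (-(1 / 2))) - c := by
    refine ge_of_tendsto hlim ?_
    filter_upwards [self_mem_nhdsWithin] with s hs
    have hs' : 0 < s + 1 / 2 := by linarith [mem_Ioi.1 hs]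
    have := mul_nonneg hs'.le (key s hs)
    have h1 : (s + 1 / 2) * (1 / (s + 1 / 2)) = 1 := mul_one_div_cancel hs'.ne'
    linear_combination this - c * h1
  norm_num at hge
  linarith

/-- The logarithm of Mertens' product: the sum of `-log (1 - 1/p)` over primes `p ≤ x`. -/
noncomputable def mertensSum (x : ℝ) : ℝ :=
  ∑ p ∈ Finset.Ioc 0 ⌊x⌋₊ with p.Prime, -Real.log (1 - 1 / p)

theorem Nat.Prime.sum_pow_div_le_neg_log {p : ℕ} (hp : p.Prime) (N : ℕ) :
    ∑ k ∈ Finset.Icc 1 N, (1 / (p : ℝ)) ^ k / k ≤ -Real.log (1 - 1 / p) := by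
  have hp1 : (1 : ℝ) < p := by exact_mod_cast hp.one_lt
  have h := Real.hasSum_pow_div_log_of_abs_lt_one (x := 1 / (p : ℝ)) (by
    rw [abs_of_pos (by positivity), div_lt_one (by linarith)]
    exact hp1)
  refine le_trans ?_ (sum_le_hasSum (Finset.range N) (fun n _ ↦ by positivity) h)
  refine le_of_eq ?_
  rw [← Finset.Ico_add_one_right_eq_Icc, Finset.sum_Ico_eq_sum_range, Nat.add_sub_cancel]
  refine Finset.sum_congr rfl fun k _ ↦ ?_
  rw [add_comm 1 k]
  push_cast
  rfl

theorem primePowerSum_le_mertensSum {x : ℝ} (hx : 1 ≤ x) : primePowerSum x ≤ mertensSum x := by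
  have h1 : primePowerSum x = ∑ n ∈ Finset.Ioc 0 ⌊x⌋₊ with IsPrimePow n,
      ArithmeticFunction.vonMangoldt n / (n * Real.log n) := by
    rw [primePowerSum, Finset.sum_filter_of_ne]
    intro n _ hn
    by_contra hcon
    exact hn (by rw [ArithmeticFunction.vonMangoldt_eq_zero_iff.2 hcon, zero_div])
  rw [h1, Chebyshev.sum_PrimePow_eq_sum_sum _ (by linarith)]
  set N := ⌊Real.log x / Real.log 2⌋₊
  calc _ ≤ ∑ k ∈ Finset.Icc 1 N, ∑ p ∈ Finset.Ioc 0 ⌊x⌋₊ with p.Prime, (1 / (p : ℝ)) ^ k / k := by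
        refine Finset.sum_le_sum fun k hk ↦ ?_
        have hk1 : 1 ≤ k := (Finset.mem_Icc.1 hk).1
        have hterm : ∀ p : ℕ, p.Prime → ArithmeticFunction.vonMangoldt (p ^ k) /
            ((p ^ k : ℕ) * Real.log (p ^ k : ℕ)) = (1 / (p : ℝ)) ^ k / k := by
          intro p hp
          have hl : 0 < Real.log p := Real.log_pos (by exact_mod_cast hp.one_lt)
          have hp0 : (0 : ℝ) < p := by exact_mod_cast hp.pos
          rw [ArithmeticFunction.vonMangoldt_apply_pow (by omega),
            ArithmeticFunction.vonMangoldt_apply_prime hp]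
          push_cast
          rw [Real.log_pow, one_div_pow]
          field_simp
        rw [Finset.sum_congr rfl fun p hp ↦ hterm p (Finset.mem_filter.1 hp).2]
        refine Finset.sum_le_sum_of_subset_of_nonneg ?_ fun p _ _ ↦ by positivity
        refine Finset.filter_subset_filter _ (Finset.Ioc_subset_Ioc_right (Nat.floor_le_floor ?_))
        calc x ^ ((1 : ℝ) / k) ≤ x ^ (1 : ℝ) := Real.rpow_le_rpow_of_exponent_le hx (by
              rw [div_le_one (by positivity)]
              exact_mod_cast hk1)
          _ = x := Real.rpow_one x
    _ = ∑ p ∈ Finset.Ioc 0 ⌊x⌋₊ with p.Prime, ∑ k ∈ Finset.Icc 1 N, (1 / (p : ℝ)) ^ k / k :=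
        Finset.sum_comm
    _ ≤ mertensSum x := Finset.sum_le_sum fun p hp ↦
        (Finset.mem_filter.1 hp).2.sum_pow_div_le_neg_log N

theorem eventually_half_sqrt_le_psi_sub_theta :
    ∀ᶠ x in atTop, 1 / 2 * √x ≤ Chebyshev.psi x - Chebyshev.theta x := by
  have hlin : ∀ᶠ y : ℝ in atTop, 1 / 2 * y ≤ (y - 1) * Real.log 2 - Real.log (y + 2) := by
    have ho := (Real.isLittleO_log_id_atTop.comp_tendsto
      (tendsto_atTop_add_const_right atTop (2 : ℝ) tendsto_id)).bound (by norm_num : (0 : ℝ) < 1 / 20)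
    filter_upwards [ho, eventually_ge_atTop 100] with y hy hy1
    have h2 := Real.log_two_gt_d9
    simp only [Function.comp, id, Real.norm_eq_abs] at hy
    rw [abs_of_pos (by linarith : 0 < y + 2)] at hy
    have := le_abs_self (Real.log (y + 2))
    nlinarith
  filter_upwards [Real.tendsto_sqrt_atTop.eventually hlin, eventually_ge_atTop 0] with x hx hx0
  have h1 := Chebyshev.psi_sub_theta_ge_psi_add_psi_add_psi hx0
  have h2 := Chebyshev.psi_nonneg (x ^ (3 : ℝ)⁻¹)
  have h3 := Chebyshev.psi_nonneg (x ^ (7 : ℝ)⁻¹)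
  have h4 := Chebyshev.psi_ge' (Real.sqrt_nonneg x)
  rw [show x ^ (2 : ℝ)⁻¹ = √x by rw [Real.sqrt_eq_rpow, one_div]] at h1
  linarith

/-- The error in (the logarithm of) Mertens' product formula. -/
noncomputable def mertensError (x : ℝ) : ℝ :=
  mertensSum x - Real.eulerMascheroniConstant - Real.log (Real.log x)

/-- `log x` times the error in Mertens' product formula, minus the relative error `(θ(x) - x) / x`. -/
noncomputable def mertensThetaGap (x : ℝ) : ℝ :=
  Real.log x * mertensError x - (Chebyshev.theta x - x) / x

theorem frequently_le_mertensThetaGap : ∃ᶠ x in atTop, 1 / 4 / √x ≤ mertensThetaGap x := by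
  intro hev
  refine not_eventually_mertensPsiGap_le (by norm_num : (0 : ℝ) < 1 / 4) ?_
  filter_upwards [Real.tendsto_exp_atTop.eventually hev,
    Real.tendsto_exp_atTop.eventually eventually_half_sqrt_le_psi_sub_theta,
    eventually_ge_atTop 0] with u h1 h2 hu
  rw [not_le] at h1
  have hsq : √(Real.exp u) = Real.exp (1 / 2 * u) := by
    rw [Real.sqrt_eq_rpow, ← Real.exp_mul, mul_comm]
  have hinv : Real.exp (-(1 / 2) * u) = 1 / Real.exp (1 / 2 * u) := by
    rw [neg_mul, Real.exp_neg, one_div (Real.exp _)]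
  have hmul : Real.exp u = Real.exp (1 / 2 * u) * Real.exp (1 / 2 * u) := by
    rw [← Real.exp_add]; ring_nf
  have hP := primePowerSum_le_mertensSum (Real.one_le_exp hu)
  rw [mertensThetaGap, mertensError, Real.log_exp, hsq] at h1
  rw [hsq] at h2
  have h3 : u * primePowerSum (Real.exp u) ≤ u * mertensSum (Real.exp u) := by gcongr
  have hpos := Real.exp_pos (1 / 2 * u)
  have h4 : 1 / 2 / Real.exp (1 / 2 * u) ≤
      (Chebyshev.psi (Real.exp u) - Chebyshev.theta (Real.exp u)) / Real.exp u := by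
    rw [div_le_div_iff₀ hpos (Real.exp_pos u)]
    calc 1 / 2 * Real.exp u = 1 / 2 * Real.exp (1 / 2 * u) * Real.exp (1 / 2 * u) := by
          rw [hmul]; ring
      _ ≤ _ := by gcongr
  rw [mertensPsiGap, hinv, Real.exp_neg, ← div_eq_mul_inv]
  have h5 : (Chebyshev.psi (Real.exp u) - Real.exp u) / Real.exp u =
      (Chebyshev.theta (Real.exp u) - Real.exp u) / Real.exp u +
      (Chebyshev.psi (Real.exp u) - Chebyshev.theta (Real.exp u)) / Real.exp u := by
    rw [← add_div]; ring
  rw [h5]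
  have h6 : 1 / 2 / Real.exp (1 / 2 * u) = 1 / 4 / Real.exp (1 / 2 * u) +
    1 / 4 * (1 / Real.exp (1 / 2 * u)) := by ring
  linarith

theorem mertensSum_mono : Monotone mertensSum := by
  intro x y hxy
  refine Finset.sum_le_sum_of_subset_of_nonneg (Finset.filter_subset_filter _
    (Finset.Ioc_subset_Ioc_right (Nat.floor_le_floor hxy))) fun p hp _ ↦ ?_
  have hp1 : (1 : ℝ) < p := by exact_mod_cast (Finset.mem_filter.1 hp).2.one_lt
  rw [neg_nonneg]
  refine Real.log_nonpos ?_ ?_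
  · rw [sub_nonneg, div_le_one (by linarith)]
    exact hp1.le
  · linarith [(by positivity : (0 : ℝ) ≤ 1 / p)]

theorem Nat.Prime.mul_neg_log_le {p : ℕ} (hp : p.Prime) :
    (p : ℝ) * -Real.log (1 - 1 / p) ≤ 1 + 2 / p := by
  have hp2 : (2 : ℝ) ≤ p := by exact_mod_cast hp.two_le
  have h0 : (0 : ℝ) < 1 - 1 / p := by
    rw [sub_pos, div_lt_one (by linarith)]
    linarith
  have h1 := Real.one_sub_inv_le_log_of_pos h0
  have h2 : (p : ℝ) * -Real.log (1 - 1 / p) ≤ p * ((1 - 1 / (p : ℝ))⁻¹ - 1) := by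
    gcongr
    linarith
  refine h2.trans ?_
  have h3 : (1 - 1 / (p : ℝ))⁻¹ = p / (p - 1) := by
    rw [one_sub_div (by linarith), inv_div]
  rw [h3, div_sub_one (by linarith), ← sub_nonneg]
  have : 1 + 2 / (p : ℝ) - p * ((p - (p - 1)) / (p - 1)) = (p - 2) / (p * (p - 1)) := by
    have : (p : ℝ) - 1 ≠ 0 := by linarith
    field_simp
    ring
  rw [this]
  exact div_nonneg (by linarith) (mul_nonneg (by linarith) (by linarith))

theorem sum_prime_mul_log_mul_neg_log_le {x y : ℝ} (hx : 1 ≤ x) (hxy : x ≤ y) :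
    ∑ p ∈ Finset.Ioc ⌊x⌋₊ ⌊y⌋₊ with p.Prime, (p : ℝ) * Real.log p * -Real.log (1 - 1 / p) ≤
      Chebyshev.theta y - Chebyshev.theta x + 2 * Real.log y * (1 + Real.log y) := by
  have hθ : Chebyshev.theta y - Chebyshev.theta x =
      ∑ p ∈ Finset.Ioc ⌊x⌋₊ ⌊y⌋₊ with p.Prime, Real.log p := by
    unfold Chebyshev.theta
    simp only [Finset.sum_filter]
    rw [← Finset.sum_Ioc_consecutive _ (Nat.zero_le _) (Nat.floor_le_floor hxy)]
    ring
  have hy0 : 0 < y := by linarith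
  have hly : 0 ≤ Real.log y := Real.log_nonneg (by linarith)
  have hharm : ∑ n ∈ Finset.Icc 1 ⌊y⌋₊, (1 / (n : ℝ)) ≤ 1 + Real.log y := by
    have h := harmonic_floor_le_one_add_log y (by linarith)
    rw [harmonic_eq_sum_Icc] at h
    push_cast at h
    simpa using h
  calc _ ≤ ∑ p ∈ Finset.Ioc ⌊x⌋₊ ⌊y⌋₊ with p.Prime, (Real.log p + 2 * Real.log y * (1 / p)) := by
        refine Finset.sum_le_sum fun p hp ↦ ?_
        obtain ⟨hp1, hp2⟩ := Finset.mem_filter.1 hp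
        have hpy : (p : ℝ) ≤ y := (Nat.le_floor_iff hy0.le).1 (Finset.mem_Ioc.1 hp1).2
        have hp0 : (0 : ℝ) < p := by exact_mod_cast hp2.pos
        have hl : 0 ≤ Real.log p := Real.log_natCast_nonneg p
        have hll : Real.log p ≤ Real.log y := Real.log_le_log hp0 hpy
        calc (p : ℝ) * Real.log p * -Real.log (1 - 1 / p)
            = Real.log p * (p * -Real.log (1 - 1 / p)) := by ring
          _ ≤ Real.log p * (1 + 2 / p) := by
              gcongr
              exact hp2.mul_neg_log_le
          _ = Real.log p + 2 * Real.log p * (1 / p) := by ring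
          _ ≤ _ := by gcongr
    _ = Chebyshev.theta y - Chebyshev.theta x +
          2 * Real.log y * ∑ p ∈ Finset.Ioc ⌊x⌋₊ ⌊y⌋₊ with p.Prime, (1 / (p : ℝ)) := by
        rw [Finset.sum_add_distrib, ← hθ, ← Finset.mul_sum]
    _ ≤ _ := by
        gcongr
        refine le_trans (Finset.sum_le_sum_of_subset_of_nonneg ?_ fun n _ _ ↦ by positivity) hharm
        intro p hp
        obtain ⟨hp1, hp2⟩ := Finset.mem_filter.1 hp
        exact Finset.mem_Icc.2 ⟨hp2.one_le, (Finset.mem_Ioc.1 hp1).2⟩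

theorem hasDerivAt_mul_log_mul {t : ℝ} (ht : 1 < t) (c : ℝ) :
    HasDerivAt (fun t ↦ t * Real.log t * (c + Real.log (Real.log t)) - t)
      ((1 + Real.log t) * (c + Real.log (Real.log t))) t := by
  have hl : 0 < Real.log t := Real.log_pos ht
  have h1 := Real.hasDerivAt_log (by linarith : t ≠ 0)
  have h2 := (((hasDerivAt_id t).mul h1).mul ((h1.log hl.ne').const_add c)).sub (hasDerivAt_id t)
  refine h2.congr_deriv ?_
  simp only [id]
  field_simp
  simp
  ring

/-- Partial summation for `x * mertensThetaGap x`. -/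
theorem mul_mertensThetaGap_sub_le {x y : ℝ} (hx : 3 ≤ x) (hxy : x ≤ y) :
    IntegrableOn (fun t ↦ (1 + Real.log t) * mertensError t) (Ioc x y) ∧
    y * mertensThetaGap y - x * mertensThetaGap x ≤
      (∫ t in Ioc x y, (1 + Real.log t) * mertensError t) +
        2 * Real.log y * (1 + Real.log y) := by
  set c : ℕ → ℝ := fun p ↦ if p.Prime then -Real.log (1 - 1 / p) else 0 with hc
  have hF : ∀ t, mertensSum t = ∑ k ∈ Finset.Icc 0 ⌊t⌋₊, c k := by
    intro t
    rw [mertensSum, Finset.sum_filter, ← Finset.add_sum_Ioc_eq_sum_Icc (Nat.zero_le _)]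
    simp [hc]
  have hd : ∀ t ∈ Icc x y, HasDerivAt (fun t ↦ t * Real.log t) (Real.log t + 1) t := fun t ht ↦
    Real.hasDerivAt_mul_log (by linarith [ht.1])
  have hcl : ContinuousOn (fun t ↦ 1 + Real.log t) (Icc x y) :=
    continuousOn_const.add (Real.continuousOn_log.mono fun t ht ↦ by
      simp only [mem_compl_iff, mem_singleton_iff]; linarith [ht.1])
  have hder : EqOn (deriv fun t ↦ t * Real.log t) (fun t ↦ 1 + Real.log t) (Icc x y) :=
    fun t ht ↦ by rw [(hd t ht).deriv, add_comm]
  have hIl : IntegrableOn (fun t ↦ 1 + Real.log t) (Icc x y) := hcl.integrableOn_Icc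
  have habel := sum_mul_eq_sub_sub_integral_mul c (by linarith) hxy
    (fun t ht ↦ (hd t ht).differentiableAt)
    ((integrableOn_congr_fun hder measurableSet_Icc).2 hIl)
  simp only [← hF] at habel
  have hI1 : IntegrableOn (fun t ↦ (1 + Real.log t) * mertensSum t) (Ioc x y) := by
    simp only [hF]
    exact (integrableOn_mul_sum_Icc c (by linarith) hIl).mono_set Ioc_subset_Icc_self
  rw [setIntegral_congr_fun measurableSet_Ioc
    (g := fun t ↦ (1 + Real.log t) * mertensSum t)
    (fun t ht ↦ by simp only [hder (Ioc_subset_Icc_self ht)])] at habel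
  have hsum : ∑ k ∈ Finset.Ioc ⌊x⌋₊ ⌊y⌋₊, (k : ℝ) * Real.log k * c k =
      ∑ p ∈ Finset.Ioc ⌊x⌋₊ ⌊y⌋₊ with p.Prime, (p : ℝ) * Real.log p * -Real.log (1 - 1 / p) := by
    rw [Finset.sum_filter]
    refine Finset.sum_congr rfl fun p _ ↦ ?_
    simp only [hc]
    split_ifs <;> simp
  rw [hsum] at habel
  have hle := sum_prime_mul_log_mul_neg_log_le (by linarith : 1 ≤ x) hxy
  set γ := Real.eulerMascheroniConstant
  have hdg : ∀ t ∈ uIcc x y, HasDerivAt (fun t ↦ t * Real.log t * (γ + Real.log (Real.log t)) - t)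
      ((1 + Real.log t) * (γ + Real.log (Real.log t))) t := fun t ht ↦ by
    rw [uIcc_of_le hxy] at ht
    exact hasDerivAt_mul_log_mul (by linarith [ht.1]) _
  have hcg : ContinuousOn (fun t ↦ (1 + Real.log t) * (γ + Real.log (Real.log t))) (uIcc x y) := by
    rw [uIcc_of_le hxy]
    refine hcl.mul (continuousOn_const.add (ContinuousOn.log ?_ ?_))
    · exact Real.continuousOn_log.mono fun t ht ↦ by
        simp only [mem_compl_iff, mem_singleton_iff]; linarith [ht.1]
    · intro t ht
      exact (Real.log_pos (by linarith [ht.1])).ne'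
  have hI2 := hcg.intervalIntegrable (μ := volume)
  have hFTC := intervalIntegral.integral_eq_sub_of_hasDerivAt hdg hI2
  rw [intervalIntegral.integral_of_le hxy] at hFTC
  have hI2' := (intervalIntegrable_iff_integrableOn_Ioc_of_le hxy).1 hI2
  have hA : (fun t ↦ (1 + Real.log t) * mertensError t) = fun t ↦
      (1 + Real.log t) * mertensSum t - (1 + Real.log t) * (γ + Real.log (Real.log t)) := by
    ext t
    rw [mertensError]; ring
  rw [hA]
  refine ⟨hI1.sub hI2', ?_⟩
  rw [integral_sub hI1 hI2', hFTC]
  have hK : ∀ z, 0 < z → z * mertensThetaGap z = z * Real.log z * mertensSum z -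
      Chebyshev.theta z - (z * Real.log z * (γ + Real.log (Real.log z)) - z) := by
    intro z hz
    rw [mertensThetaGap, mertensError]
    field_simp
    ring
  rw [hK y (by linarith), hK x (by linarith)]
  linarith

theorem mul_mertensThetaGap_sub_le_of_forall {x y ε : ℝ} (hε : 0 ≤ ε) (hx : 3 ≤ x) (hxy : x ≤ y)
    (h : ∀ t ∈ Ioc x y, Real.log t * mertensError t ≤ ε / √t) :
    y * mertensThetaGap y - x * mertensThetaGap x ≤
      4 * ε * √y + 2 * Real.log y * (1 + Real.log y) := by
  obtain ⟨hI, hle⟩ := mul_mertensThetaGap_sub_le hx hxy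
  have hd : ∀ t ∈ uIcc x y, HasDerivAt (fun t ↦ 4 * ε * √t) (2 * ε / √t) t := fun t ht ↦ by
    rw [uIcc_of_le hxy] at ht
    refine ((Real.hasDerivAt_sqrt (by linarith [ht.1])).const_mul (4 * ε)).congr_deriv ?_
    ring
  have hc : ContinuousOn (fun t ↦ 2 * ε / √t) (uIcc x y) := by
    rw [uIcc_of_le hxy]
    exact continuousOn_const.div Real.continuous_sqrt.continuousOn fun t ht ↦
      (Real.sqrt_pos.2 (by linarith [ht.1])).ne'
  have hFTC := intervalIntegral.integral_eq_sub_of_hasDerivAt hd hc.intervalIntegrable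
  rw [intervalIntegral.integral_of_le hxy] at hFTC
  have hmono : ∫ t in Ioc x y, (1 + Real.log t) * mertensError t ≤ ∫ t in Ioc x y, 2 * ε / √t := by
    refine setIntegral_mono_on hI
      ((intervalIntegrable_iff_integrableOn_Ioc_of_le hxy).1 hc.intervalIntegrable)
      measurableSet_Ioc fun t ht ↦ ?_
    have ht3 : Real.exp 1 ≤ t := by linarith [Real.exp_one_lt_d9, ht.1]
    have hlog : 1 ≤ Real.log t := (Real.le_log_iff_exp_le (by linarith [ht.1])).2 ht3
    have hε' : 0 ≤ ε / √t := by positivity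
    have h1 := h t ht
    rw [mul_div_assoc]
    rcases le_total 0 (mertensError t) with hA | hA <;> nlinarith
  have : 0 ≤ 4 * ε * √x := by positivity
  linarith

theorem exists_mertensError_ge_and_mertensThetaGap_ge (X : ℝ) :
    ∃ x, X ≤ x ∧ 1 / 100 / √x ≤ Real.log x * mertensError x ∧
      1 / 100 / √x ≤ mertensThetaGap x := by
  wlog hX : 3 ≤ X generalizing X
  · obtain ⟨x, hx, h⟩ := this (max X 3) (le_max_right _ _)
    exact ⟨x, (le_max_left _ _).trans hx, h⟩
  have hslop : ∀ᶠ y : ℝ in atTop, 2 * Real.log y * (1 + Real.log y) ≤ 1 / 10 * √y := by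
    have h1 := (isLittleO_log_rpow_atTop (by norm_num : (0 : ℝ) < 1 / 4)).bound
      (by norm_num : (0 : ℝ) < 1 / 10)
    filter_upwards [h1, eventually_ge_atTop (Real.exp 1)] with y hy hy1
    have hy0 : 0 < y := (Real.exp_pos 1).trans_le hy1
    have hl : 1 ≤ Real.log y := (Real.le_log_iff_exp_le hy0).2 hy1
    rw [Real.norm_of_nonneg (by linarith), Real.norm_of_nonneg (by positivity)] at hy
    have hsq : √y = y ^ (1 / 4 : ℝ) * y ^ (1 / 4 : ℝ) := by
      rw [← Real.rpow_add hy0, Real.sqrt_eq_rpow]; norm_num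
    have h0 : 0 ≤ y ^ (1 / 4 : ℝ) := by positivity
    rw [hsq]
    nlinarith [mul_le_mul hy hy (by linarith) (by positivity)]
  have hbig : ∀ᶠ y : ℝ in atTop, X * mertensThetaGap X < 1 / 100 * √y :=
    (Real.tendsto_sqrt_atTop.const_mul_atTop (by norm_num : (0 : ℝ) < 1 / 100)).eventually_gt_atTop _
  obtain ⟨y, hy, hys, hyb, hXy⟩ := (frequently_le_mertensThetaGap.and_eventually
    (hslop.and (hbig.and (eventually_ge_atTop X)))).exists
  have hy0 : 0 < y := by linarith
  have hyK : 1 / 4 * √y ≤ y * mertensThetaGap y := by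
    have h1 : y * (1 / 4 / √y) ≤ y * mertensThetaGap y := by gcongr
    have h2 : y * (1 / 4 / √y) = 1 / 4 * √y := by
      rw [mul_div_assoc', mul_comm, mul_div_assoc, Real.div_sqrt]
    linarith
  set S : Set ℝ := {x | X ≤ x ∧ x ≤ y ∧ 1 / 100 / √x ≤ Real.log x * mertensError x} with hS
  have hback : ∀ x, X ≤ x → x ≤ y → (∀ t ∈ Ioc x y, t ∉ S) → 1 / 100 * √y ≤ x * mertensThetaGap x := by
    intro x hx hxy hno
    have := mul_mertensThetaGap_sub_le_of_forall (ε := 1 / 100) (by norm_num) (by linarith) hxy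
      fun t ht ↦ by
        by_contra hcon
        exact hno t ht ⟨hx.trans ht.1.le, ht.2, (not_le.1 hcon).le⟩
    linarith [Real.sqrt_nonneg y]
  have hne : S.Nonempty := by
    by_contra hcon
    rw [not_nonempty_iff_eq_empty] at hcon
    have := hback X le_rfl hXy fun t _ ↦ by simp [hcon]
    linarith
  have hbdd : BddAbove S := ⟨y, fun x hx ↦ hx.2.1⟩
  set x := sSup S with hx
  have hXx : X ≤ x := by
    obtain ⟨z, hz⟩ := hne
    exact hz.1.trans (le_csSup hbdd hz)
  have hxy : x ≤ y := csSup_le hne fun z hz ↦ hz.2.1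
  have hx0 : 0 < x := by linarith
  have hlx : 0 < Real.log x := Real.log_pos (by linarith)
  have hxA : 1 / 100 / √x ≤ Real.log x * mertensError x := by
    have : (𝓝[S] x).NeBot := mem_closure_iff_nhdsWithin_neBot.1 (csSup_mem_closure hne hbdd)
    have hcont : ContinuousAt (fun z ↦ 1 / 100 / √z / Real.log z + Real.log (Real.log z)) x := by
      have h1 : ContinuousAt Real.log x := Real.continuousAt_log hx0.ne'
      refine ((continuousAt_const.div Real.continuous_sqrt.continuousAt ?_).div h1 hlx.ne').add
        (h1.log hlx.ne')
      exact (Real.sqrt_pos.2 hx0).ne'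
    have hlim := hcont.tendsto.mono_left (nhdsWithin_le_nhds (s := S))
    have hle := le_of_tendsto hlim (b := mertensSum x - Real.eulerMascheroniConstant) (by
      filter_upwards [self_mem_nhdsWithin] with z hz
      have hlz : 0 < Real.log z := Real.log_pos (by linarith [hz.1])
      have h1 := mertensSum_mono (le_csSup hbdd hz)
      have h2 := (div_le_iff₀' hlz).2 hz.2.2
      rw [mertensError] at h2
      linarith)
    rw [mul_comm, ← div_le_iff₀ hlx, mertensError]
    linarith
  refine ⟨x, hXx, hxA, ?_⟩
  have h1 := hback x hXx hxy fun t ht hts ↦ absurd (le_csSup hbdd hts) (not_le.2 ht.1)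
  have h2 : √x ≤ √y := Real.sqrt_le_sqrt hxy
  have h3 : x * (1 / 100 / √x) = 1 / 100 * √x := by
    rw [mul_div_assoc', mul_comm, mul_div_assoc, Real.div_sqrt]
  refine le_of_mul_le_mul_left ?_ hx0
  linarith

theorem prod_range_count_nth_prime {M : Type*} [CommMonoid M] (m : ℕ) (f : ℕ → M) :
    ∏ i ∈ Finset.range (Nat.count Nat.Prime (m + 1)), f (Nat.nth Nat.Prime i) =
      ∏ p ∈ Nat.primesLE m, f p := by
  have himg : Nat.primesLE m =
      (Finset.range (Nat.count Nat.Prime (m + 1))).image (Nat.nth Nat.Prime) := by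
    ext p
    simp only [Nat.mem_primesLE, Finset.mem_image, Finset.mem_range]
    constructor
    · rintro ⟨hpm, hp⟩
      exact ⟨Nat.count Nat.Prime p, Nat.count_strict_mono hp (by omega), Nat.nth_count hp⟩
    · rintro ⟨i, hi, rfl⟩
      exact ⟨Nat.lt_succ_iff.1 (Nat.nth_lt_of_lt_count hi), Nat.prime_nth_prime i⟩
  rw [himg, Finset.prod_image fun a _ b _ h ↦ Nat.nth_injective Nat.infinite_setOfPred_prime h]

theorem isInitialPrimeProduct_two_pow_mul_primorial {m a : ℕ} (hm : 2 ≤ m) {y : ℝ} (hy : m ≤ y) :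
    IsInitialPrimeProduct (2 ^ a * primorial m) y := by
  have hpos : 0 < Nat.count Nat.Prime (m + 1) := by
    have : Nat.count Nat.Prime 2 < Nat.count Nat.Prime (m + 1) :=
      Nat.count_strict_mono Nat.prime_two (by omega)
    omega
  refine ⟨Nat.count Nat.Prime (m + 1) - 1, fun i ↦ if i = 0 then a + 1 else 1, ?_, ?_, ?_⟩
  · intro i _
    dsimp only
    split_ifs <;> omega
  · rw [Nat.sub_add_cancel hpos, primorial_eq_prod_primesLE,
      ← prod_range_count_nth_prime m fun p ↦ p]
    obtain ⟨j, hj⟩ : ∃ j, Nat.count Nat.Prime (m + 1) = j + 1 := ⟨_, (Nat.sub_add_cancel hpos).symm⟩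
    rw [hj, Finset.prod_range_succ', Finset.prod_range_succ']
    simp only [Nat.add_eq_zero_iff, one_ne_zero, and_false, if_false, if_true, pow_one,
      Nat.nth_prime_zero_eq_two]
    rw [pow_succ, mul_left_comm]
  · refine le_trans ?_ hy
    exact_mod_cast Nat.lt_succ_iff.1
      (Nat.nth_lt_of_lt_count (by omega : Nat.count Nat.Prime (m + 1) - 1 < Nat.count Nat.Prime (m + 1)))

theorem div_totient_two_pow_mul_primorial {x : ℝ} (hx : 2 ≤ x) (a : ℕ) :
    ((2 ^ a * primorial ⌊x⌋₊ : ℕ) : ℝ) / (Nat.totient (2 ^ a * primorial ⌊x⌋₊) : ℝ) =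
      Real.exp (mertensSum x) := by
  have hm : 2 ≤ ⌊x⌋₊ := Nat.le_floor hx
  set N := 2 ^ a * primorial ⌊x⌋₊ with hN
  have hN0 : N ≠ 0 := mul_ne_zero (by positivity) (primorial_pos _).ne'
  have hfac : N.primeFactors = Nat.primesLE ⌊x⌋₊ := by
    rw [hN, Nat.primeFactors_mul (by positivity) (primorial_pos _).ne', primeFactors_primorial]
    refine Finset.union_eq_right.2 fun p hp ↦ ?_
    have hp2 : p = 2 := (Nat.prime_dvd_prime_iff_eq (Nat.prime_of_mem_primeFactors hp)
      Nat.prime_two).1 ((Nat.prime_of_mem_primeFactors hp).dvd_of_dvd_pow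
        (Nat.dvd_of_mem_primeFactors hp))
    rw [hp2, Nat.mem_primesLE]
    exact ⟨hm, Nat.prime_two⟩
  have htot : (Nat.totient N : ℝ) = N * ∏ p ∈ Nat.primesLE ⌊x⌋₊, (1 - 1 / (p : ℝ)) := by
    have h := Nat.totient_eq_mul_prod_factors N
    rw [hfac] at h
    have h2 := congrArg (fun q : ℚ ↦ (q : ℝ)) h
    push_cast at h2
    simpa using h2
  have hexp : Real.exp (mertensSum x) = (∏ p ∈ Nat.primesLE ⌊x⌋₊, (1 - 1 / (p : ℝ)))⁻¹ := by
    rw [mertensSum, ← Nat.primesLE_eq_filter_Ioc_zero, Real.exp_sum, ← Finset.prod_inv_distrib]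
    refine Finset.prod_congr rfl fun p hp ↦ ?_
    have hp1 : (1 : ℝ) < p := by exact_mod_cast (Nat.mem_primesLE.1 hp).2.one_lt
    rw [Real.exp_neg, Real.exp_log]
    rw [sub_pos, div_lt_one (by linarith)]
    exact hp1
  rw [htot, hexp, div_mul_cancel_left₀ (by exact_mod_cast hN0)]

theorem exists_isInitialPrimeProduct {x : ℝ} (hx : 2 ≤ x) :
    ∃ N : ℕ, IsInitialPrimeProduct N (Real.log N) ∧ x ≤ Real.log N ∧
      Real.log N ≤ max (Chebyshev.theta x) (x + Real.log 2) ∧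
      (N : ℝ) / (Nat.totient N : ℝ) = Real.exp (mertensSum x) := by
  set a := ⌈(x - Chebyshev.theta x) / Real.log 2⌉₊ with ha
  have hl2 : 0 < Real.log 2 := Real.log_pos (by norm_num)
  have hlog : Real.log ((2 ^ a * primorial ⌊x⌋₊ : ℕ) : ℝ) = a * Real.log 2 + Chebyshev.theta x := by
    push_cast
    rw [Real.log_mul (by positivity) (by exact_mod_cast (primorial_pos _).ne'), Real.log_pow,
      Chebyshev.theta_eq_log_primorial]
  have hge : x ≤ a * Real.log 2 + Chebyshev.theta x := by
    have := Nat.le_ceil ((x - Chebyshev.theta x) / Real.log 2)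
    rw [← ha, div_le_iff₀ hl2] at this
    linarith
  refine ⟨2 ^ a * primorial ⌊x⌋₊, isInitialPrimeProduct_two_pow_mul_primorial (Nat.le_floor hx) ?_,
    ?_, ?_, div_totient_two_pow_mul_primorial hx a⟩
  · rw [hlog]
    exact (Nat.floor_le (by linarith)).trans hge
  · rwa [hlog]
  · rw [hlog]
    rcases le_total x (Chebyshev.theta x) with h | h
    · have : a = 0 := Nat.ceil_eq_zero.2 (div_nonpos_of_nonpos_of_nonneg (by linarith) hl2.le)
      rw [this]
      simp
    · refine le_max_of_le_right ?_
      have := Nat.ceil_lt_add_one (div_nonneg (sub_nonneg.2 h) hl2.le)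
      rw [← ha] at this
      have h2 := mul_lt_mul_of_pos_right this hl2
      rw [add_mul, div_mul_cancel₀ _ hl2.ne'] at h2
      linarith

theorem log_mul_log_log_sub_le {x l : ℝ} (hx : 1 < x) (hl : x ≤ l) :
    Real.log x * (Real.log (Real.log l) - Real.log (Real.log x)) ≤ (l - x) / x := by
  have hx0 : 0 < x := by linarith
  have hlx : 0 < Real.log x := Real.log_pos hx
  have hll : 0 < Real.log l := Real.log_pos (by linarith)
  have h1 := Real.log_le_sub_one_of_pos (div_pos hll hlx)
  rw [Real.log_div hll.ne' hlx.ne', div_sub_one hlx.ne', le_div_iff₀' hlx] at h1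
  have h2 := Real.log_le_sub_one_of_pos (div_pos (by linarith : 0 < l) hx0)
  rw [Real.log_div (by linarith) hx0.ne', div_sub_one hx0.ne'] at h2
  linarith

theorem totient_ratio_extreme_values (c₀ : ℝ) (hc₀ : 1 ≤ c₀) :
    ∃ c₁ : ℝ, 0 < c₁ ∧
      {N : ℕ | IsInitialPrimeProduct N (c₀ * Real.log N) ∧
        (N : ℝ) / (Nat.totient N : ℝ) ≥
          Real.exp Real.eulerMascheroniConstant * Real.log (Real.log N) +
            c₁ * (Real.log N) ^ (-(1 / 2) : ℝ) *
              Real.log (Real.log (Real.log (Real.log N))) / Real.log (Real.log N)}.Infinite := by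
  refine ⟨1 / 200, by norm_num, Set.infinite_of_forall_exists_gt fun n ↦ ?_⟩
  obtain ⟨x, hx, hA, hK⟩ := exists_mertensError_ge_and_mertensThetaGap_ge (max n 40000)
  have hxn : (n : ℝ) ≤ x := (le_max_left _ _).trans hx
  have hx4 : 40000 ≤ x := (le_max_right _ _).trans hx
  obtain ⟨N, ⟨k, v, hv, hprod, hk⟩, hxl, hlmax, hratio⟩ := exists_isInitialPrimeProduct (by linarith : 2 ≤ x)
  set l := Real.log N with hl
  have hx0 : 0 < x := by linarith
  have hl0 : 0 < l := by linarith
  have hN0 : 0 < (N : ℝ) := by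
    rcases (Nat.cast_nonneg N : (0 : ℝ) ≤ N).eq_or_lt with h | h
    · rw [hl, ← h, Real.log_zero] at hl0
      exact absurd hl0 (lt_irrefl _)
    · exact h
  refine ⟨N, ⟨⟨k, v, hv, hprod, hk.trans (le_mul_of_one_le_left hl0.le hc₀)⟩, ?_⟩, ?_⟩
  swap
  · have := Real.log_le_sub_one_of_pos hN0
    exact_mod_cast (by linarith : (n : ℝ) < N)
  rw [hratio]
  have hlx : 1 < Real.log x := (Real.lt_log_iff_exp_lt hx0).2 (by linarith [Real.exp_one_lt_d9])
  have hlogl : Real.log x ≤ Real.log l := Real.log_le_log hx0 hxl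
  have hll0 : 0 < Real.log l := by linarith
  have hsx : 0 < √x := Real.sqrt_pos.2 hx0
  set t := mertensSum x - Real.eulerMascheroniConstant - Real.log (Real.log l) with ht
  have hlt : 1 / 200 / √x ≤ Real.log x * t := by
    have h1 := log_mul_log_log_sub_le (by linarith : 1 < x) hxl
    have h2 : Real.log x * mertensError x - (l - x) / x ≤ Real.log x * t := by
      rw [ht, mertensError]
      linarith
    refine le_trans ?_ h2
    rcases le_max_iff.1 hlmax with h | h
    · have h3 : (l - x) / x ≤ (Chebyshev.theta x - x) / x := by gcongr
      rw [mertensThetaGap] at hK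
      have h4 : 1 / 200 / √x ≤ 1 / 100 / √x := by gcongr; norm_num
      linarith
    · have h3 : (l - x) / x ≤ 1 / 200 / √x := by
        rw [div_le_div_iff₀ hx0 hsx]
        have h4 : l - x ≤ 1 := by linarith [Real.log_two_lt_d9]
        have h5 : 200 ≤ √x := Real.le_sqrt_of_sq_le (by linarith)
        have h6 : √x * √x = x := Real.mul_self_sqrt hx0.le
        nlinarith
      have h4 : 1 / 100 / √x = 1 / 200 / √x + 1 / 200 / √x := by ring
      linarith
  have ht0 : 0 < t := by
    have : 0 < Real.log x * t := lt_of_lt_of_le (by positivity) hlt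
    exact (mul_pos_iff_of_pos_left (by linarith)).1 this
  have hmain : Real.exp Real.eulerMascheroniConstant * Real.log l + 1 / 200 / √x ≤
      Real.exp (mertensSum x) := by
    have h1 : mertensSum x = Real.eulerMascheroniConstant + Real.log (Real.log l) + t := by
      rw [ht]; ring
    rw [h1, Real.exp_add, Real.exp_add, Real.exp_log hll0]
    have h2 : 1 ≤ Real.exp Real.eulerMascheroniConstant :=
      Real.one_le_exp (by linarith [Real.one_half_lt_eulerMascheroniConstant])
    have h3 : t + 1 ≤ Real.exp t := Real.add_one_le_exp t
    calc _ ≤ Real.exp Real.eulerMascheroniConstant * Real.log l + 1 * Real.log l * t := by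
          have : Real.log x * t ≤ Real.log l * t := by gcongr
          linarith
      _ ≤ Real.exp Real.eulerMascheroniConstant * Real.log l +
            Real.exp Real.eulerMascheroniConstant * Real.log l * t := by gcongr
      _ = Real.exp Real.eulerMascheroniConstant * Real.log l * (t + 1) := by ring
      _ ≤ _ := by gcongr
  have hpow : l ^ (-(1 / 2) : ℝ) ≤ 1 / √x := by
    rw [Real.rpow_neg hl0.le, ← Real.sqrt_eq_rpow, ← one_div]
    gcongr
  have hlll : Real.log (Real.log (Real.log l)) ≤ Real.log l := by
    have h1 : 0 < Real.log (Real.log l) := Real.log_pos (by linarith)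
    have h2 := Real.log_le_sub_one_of_pos h1
    have h3 := Real.log_le_sub_one_of_pos hll0
    linarith
  have herr : 1 / 200 * l ^ (-(1 / 2) : ℝ) * Real.log (Real.log (Real.log l)) / Real.log l ≤
      1 / 200 / √x := by
    rw [div_le_iff₀ hll0]
    calc _ ≤ 1 / 200 * l ^ (-(1 / 2) : ℝ) * Real.log l := by gcongr
      _ ≤ 1 / 200 * (1 / √x) * Real.log l := by gcongr
      _ = _ := by ring
  exact (add_le_add_right herr _).trans hmain
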